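/- arXiv:1910.11719 — 2 statements merged into one kernel-verified Lean document; each statement's English description precedes it below -/
import Mathlib

section
/- Let d ≥ 1, b ∈ (0, (2d)^{−1}), g ∈ C²(ℝ^d), n ∈ ℕ, and let ℓ₁ be a positive integer; set N := 2ℓ₁n, α := 1/(2 sin²(π/(2ℓ₁))), and α_j := 2α sin²(jπ/(2N)) for 0 ≤ j ≤ N. With t_i := −b + 2ib/n and Δ_i := ∏_{m=1}^d [t_{i_m}, t_{i_m+1}] for i ∈ {0,…,n−1}^d, define the cells I_{i,j} := {(x,y) : x ∈ Δ_i, g(x) − y ∈ [α_j, α_{j+1}]} for (i, j) ∈ {0,…,n−1}^d × {0,…,n−1}. Then for every 0 < p ≤ ∞ and r ∈ ℕ there exists ℓ = ℓ(p, r, d) > 0 such that for all (i, j), (k, l) ∈ {0,…,n−1}^d × {0,…,n−1} and every algebraic polynomial Q on ℝ^{d+1} of total degree ≤ r: ‖Q‖_{L^p(I_{i,j})} ≤ C (1 + max{‖i−k‖_∞, |j−l|})^ℓ · ‖Q‖_{L^p(I_{k,l})}, where C depends only on p, d, r and the sup of the second-order partial derivatives of g on [−b, b]^d. -/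
open MeasureTheory ENNReal NNReal

noncomputable section

/-- first `d` coordinates of a point of `ℝ^{d+1}` -/
def xpart {d : ℕ} (ξ : EuclideanSpace ℝ (Fin (d + 1))) : EuclideanSpace ℝ (Fin d) :=
  (EuclideanSpace.equiv (Fin d) ℝ).symm (fun i => ξ i.castSucc)

/-- last coordinate of a point of `ℝ^{d+1}` -/
def ypart {d : ℕ} (ξ : EuclideanSpace ℝ (Fin (d + 1))) : ℝ := ξ (Fin.last d)

/-- grid point `t_i = -b + 2ib/n` -/
def gridPt (b : ℝ) (n i : ℕ) : ℝ := -b + 2 * i * b / n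

/-- Chebyshev partition points `α_j = 2α sin²(jπ/(2N))` -/
def chebPt (α : ℝ) (N j : ℕ) : ℝ := 2 * α * Real.sin (j * Real.pi / (2 * N)) ^ 2

/-- The function on Euclidean space given by the polynomial with exponents in `T` and
coefficients `c`. -/
def coeffEval {ι : Type*} [Fintype ι] {T : Finset (ι →₀ ℕ)} (c : T → ℝ)
    (x : EuclideanSpace ℝ ι) : ℝ :=
  ∑ s : T, c s * ∏ i, x i ^ s.1 i

lemma EuclideanSpace.norm_le_card_mul {ι : Type*} [Fintype ι] (x : EuclideanSpace ℝ ι) {a : ℝ}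
    (ha : 0 ≤ a) (h : ∀ i, |x i| ≤ a) : ‖x‖ ≤ Fintype.card ι * a := by
  rw [EuclideanSpace.norm_eq]
  refine Real.sqrt_le_iff.2 ⟨by positivity, ?_⟩
  calc ∑ i, ‖x i‖ ^ 2 ≤ ∑ _i : ι, a ^ 2 := by
        gcongr with i
        exact h i
    _ = Fintype.card ι * a ^ 2 := by simp
    _ ≤ (Fintype.card ι * a) ^ 2 := by
        rw [mul_pow]
        gcongr
        exact_mod_cast Nat.le_self_pow two_ne_zero _

lemma exists_coeffEval_ne_zero {ι : Type*} [Fintype ι] {T : Finset (ι →₀ ℕ)} {c : T → ℝ}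
    (hc : c ≠ 0) : ∃ z ∈ Metric.ball (0 : EuclideanSpace ℝ ι) 1, coeffEval c z ≠ 0 := by
  classical
  by_contra! H
  apply hc
  set P : MvPolynomial ι ℝ := ∑ s : T, MvPolynomial.monomial s.1 (c s) with hP
  have hev : ∀ x : ι → ℝ, MvPolynomial.eval x P = coeffEval c (WithLp.toLp 2 x) := by
    intro x
    simp [hP, coeffEval, MvPolynomial.eval_monomial, Finsupp.prod_fintype]
  have h0 : P = 0 := by
    have hpos : (0 : ℝ) < 1 / (Fintype.card ι + 1) := by positivity
    refine MvPolynomial.funext_set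
      (fun _ => Set.Icc (0 : ℝ) (1 / (Fintype.card ι + 1))) (fun _ => Set.Icc_infinite hpos) ?_
    intro x hx
    rw [hev, map_zero]
    apply H
    rw [mem_ball_zero_iff]
    refine (EuclideanSpace.norm_le_card_mul _ hpos.le fun i => ?_).trans_lt ?_
    · have := hx i trivial
      rw [abs_of_nonneg this.1]
      exact this.2
    · rw [mul_one_div, div_lt_one (by positivity)]
      linarith
  funext s
  have hcoeff := congrArg (MvPolynomial.coeff s.1) h0
  rw [hP, MvPolynomial.coeff_sum] at hcoeff
  simp only [MvPolynomial.coeff_monomial, MvPolynomial.coeff_zero] at hcoeff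
  rw [Finset.sum_eq_single s] at hcoeff
  · simpa using hcoeff
  · intro t _ ht
    simp [Subtype.coe_injective.ne ht]
  · simp

lemma continuous_coeffEval {ι : Type*} [Fintype ι] (T : Finset (ι →₀ ℕ)) :
    Continuous fun q : (T → ℝ) × EuclideanSpace ℝ ι => coeffEval q.1 q.2 := by
  unfold coeffEval
  fun_prop

lemma coeffEval_smul {ι : Type*} [Fintype ι] {T : Finset (ι →₀ ℕ)} (a : ℝ) (c : T → ℝ) :
    (coeffEval (a • c) : EuclideanSpace ℝ ι → ℝ) = a • coeffEval c := by
  funext x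
  simp [coeffEval, Finset.mul_sum, mul_assoc]

lemma exists_le_eLpNorm_coeffEval {ι : Type*} [Fintype ι] (T : Finset (ι →₀ ℕ)) {p : ℝ≥0∞}
    (hp : 0 < p) : ∃ κ : ℝ≥0∞, 0 < κ ∧ κ ≠ ∞ ∧ ∀ c ∈ Metric.sphere (0 : T → ℝ) 1,
      κ ≤ eLpNorm (coeffEval c) p
        (volume.restrict (Metric.closedBall (0 : EuclideanSpace ℝ ι) 1)) := by
  refine (isCompact_sphere (0 : T → ℝ) 1).induction_on (p := fun s => ∃ κ : ℝ≥0∞, 0 < κ ∧ κ ≠ ∞ ∧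
    ∀ c ∈ s, κ ≤ eLpNorm (coeffEval c) p
        (volume.restrict (Metric.closedBall (0 : EuclideanSpace ℝ ι) 1))) ?_ ?_ ?_ ?_
  · exact ⟨1, by simp, by simp, by simp⟩
  · rintro s t hst ⟨κ, h0, hκ, h⟩
    exact ⟨κ, h0, hκ, fun c hc => h c (hst hc)⟩
  · rintro s t ⟨κ, h0, hκ, h⟩ ⟨κ', h0', hκ', h'⟩
    refine ⟨min κ κ', lt_min h0 h0', by simp [hκ], ?_⟩
    rintro c (hc | hc)
    · exact (min_le_left _ _).trans (h c hc)
    · exact (min_le_right _ _).trans (h' c hc)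
  · intro c hc
    have hc0 : c ≠ 0 := by
      rintro rfl
      simp at hc
    obtain ⟨z, hz, hcz⟩ := exists_coeffEval_ne_zero hc0
    set ε := |coeffEval c z| / 2 with hε
    have hεpos : 0 < ε := by positivity
    have hev : ∀ᶠ q in nhds (c, z), ε < |coeffEval q.1 q.2| :=
      (continuous_coeffEval T).abs.continuousAt.eventually_const_lt
        (half_lt_self (abs_pos.2 hcz))
    rw [nhds_prod_eq] at hev
    obtain ⟨A, hA, B, hB, hAB⟩ := Filter.eventually_prod_iff.1 hev
    obtain ⟨U, hUB, hUo, hzU⟩ := mem_nhds_iff.1 (hB.and (Metric.isOpen_ball.mem_nhds hz))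
    have hUsub : U ⊆ Metric.closedBall 0 1 :=
      fun x hx => Metric.ball_subset_closedBall (hUB hx).2
    have hμ : volume U ≠ 0 := (hUo.measure_pos _ ⟨z, hzU⟩).ne'
    have hμ' : volume U ≠ ∞ :=
      ((measure_mono hUsub).trans_lt measure_closedBall_lt_top).ne
    refine ⟨{c | A c}, mem_nhdsWithin_of_mem_nhds hA,
      ENNReal.ofReal ε * volume U ^ (1 / p.toReal), ?_, ?_, ?_⟩
    · exact ENNReal.mul_pos (by simpa using hεpos)
        (ENNReal.rpow_pos (pos_iff_ne_zero.2 hμ) hμ').ne'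
    · exact ENNReal.mul_ne_top (by simp) (ENNReal.rpow_ne_top_of_nonneg (by positivity) hμ')
    · intro c' hc'
      calc ENNReal.ofReal ε * volume U ^ (1 / p.toReal)
          = eLpNorm (fun _ : EuclideanSpace ℝ ι => ε) p (volume.restrict U) := by
            rw [eLpNorm_const _ hp.ne' (by simpa using hμ), Measure.restrict_apply_univ,
              Real.enorm_of_nonneg hεpos.le]
        _ ≤ eLpNorm (coeffEval c') p (volume.restrict U) := by
            refine eLpNorm_mono_ae ?_
            filter_upwards [ae_restrict_mem hUo.measurableSet] with x hx
            rw [Real.norm_of_nonneg hεpos.le]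
            exact (hAB hc' (hUB hx).1).le
        _ ≤ _ := eLpNorm_mono_measure _ (Measure.restrict_mono hUsub le_rfl)

lemma abs_coeffEval_le {ι : Type*} [Fintype ι] {T : Finset (ι →₀ ℕ)} {r : ℕ}
    (hT : ∀ s ∈ T, s.degree ≤ r) (c : T → ℝ) {R : ℝ} (hR : 1 ≤ R) {x : EuclideanSpace ℝ ι}
    (hx : ‖x‖ ≤ R) : |coeffEval c x| ≤ T.card * ‖c‖ * R ^ r := by
  calc |coeffEval c x| ≤ ∑ s : T, |c s * ∏ i, x i ^ s.1 i| := Finset.abs_sum_le_sum_abs _ _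
    _ ≤ ∑ _s : T, ‖c‖ * R ^ r := by
        gcongr with s
        rw [abs_mul, Finset.abs_prod]
        refine mul_le_mul (norm_le_pi_norm c s) ?_ (by positivity) (norm_nonneg c)
        calc ∏ i, |x i ^ s.1 i| ≤ ∏ i, R ^ s.1 i := by
              refine Finset.prod_le_prod (fun i _ => abs_nonneg _) fun i _ => ?_
              rw [abs_pow]
              exact pow_le_pow_left₀ (abs_nonneg _) ((PiLp.norm_apply_le x i).trans hx) _
          _ = R ^ s.1.degree := by rw [Finset.prod_pow_eq_pow_sum, Finsupp.degree_eq_sum]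
          _ ≤ R ^ r := pow_le_pow_right₀ hR (hT s.1 s.2)
    _ = _ := by simp [mul_assoc]

lemma eLpNorm_coeffEval_closedBall_le {ι : Type*} [Fintype ι] {T : Finset (ι →₀ ℕ)} {r : ℕ}
    (hT : ∀ s ∈ T, s.degree ≤ r) (p : ℝ≥0∞) (c : T → ℝ) {R : ℝ} (hR : 1 ≤ R) :
    eLpNorm (coeffEval c) p (volume.restrict (Metric.closedBall (0 : EuclideanSpace ℝ ι) R)) ≤
      volume (Metric.ball (0 : EuclideanSpace ℝ ι) 1) ^ p.toReal⁻¹ *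
        T.card * ENNReal.ofReal (R ^ (r + Fintype.card ι * p.toReal⁻¹)) * ‖c‖ₑ := by
  have hR0 : 0 < R := by linarith
  refine (eLpNorm_le_of_ae_bound (C := T.card * ‖c‖ * R ^ r) ?_).trans (le_of_eq ?_)
  · filter_upwards [ae_restrict_mem measurableSet_closedBall] with x hx
    exact abs_coeffEval_le hT c hR (mem_closedBall_zero_iff.1 hx)
  · rw [Measure.restrict_apply_univ, Measure.addHaar_closedBall _ _ hR0.le,
      ENNReal.mul_rpow_of_nonneg _ _ (by positivity), finrank_euclideanSpace,
      ENNReal.ofReal_rpow_of_nonneg (by positivity) (by positivity),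
      ENNReal.ofReal_mul (by positivity), ENNReal.ofReal_mul (by positivity), ofReal_norm,
      ENNReal.ofReal_natCast, Real.rpow_add hR0, ENNReal.ofReal_mul (by positivity),
      Real.rpow_natCast, Real.rpow_natCast_mul hR0.le]
    ring

/-- Growth of the `L^p` norm of polynomials of bounded degree over dilated balls. -/
theorem exists_eLpNorm_closedBall_le {ι : Type*} [Fintype ι] (r : ℕ) {p : ℝ≥0∞} (hp : 0 < p) :
    ∃ K : ℝ≥0, 0 < K ∧ ∀ Q : MvPolynomial ι ℝ, Q.totalDegree ≤ r → ∀ R : ℝ, 1 ≤ R →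
      eLpNorm (fun x : EuclideanSpace ℝ ι => MvPolynomial.eval (fun i => x i) Q) p
          (volume.restrict (Metric.closedBall 0 R)) ≤
        K * ENNReal.ofReal (R ^ (r + Fintype.card ι * p.toReal⁻¹)) *
          eLpNorm (fun x : EuclideanSpace ℝ ι => MvPolynomial.eval (fun i => x i) Q) p
            (volume.restrict (Metric.closedBall 0 1)) := by
  classical
  set T : Finset (ι →₀ ℕ) := (Finsupp.finite_of_degree_le r).toFinset with hTdef
  have hT : ∀ s ∈ T, s.degree ≤ r := by simp [hTdef]
  obtain ⟨κ, hκ0, hκ, hle⟩ := exists_le_eLpNorm_coeffEval (ι := ι) T hp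
  set V := volume (Metric.ball (0 : EuclideanSpace ℝ ι) 1) ^ p.toReal⁻¹ * T.card with hV
  have hVtop : V ≠ ∞ := ENNReal.mul_ne_top
    (ENNReal.rpow_ne_top_of_nonneg (by positivity) measure_ball_lt_top.ne) (by simp)
  have hVκ : V / κ ≠ ∞ := ENNReal.div_ne_top hVtop hκ0.ne'
  refine ⟨(V / κ).toNNReal + 1, by positivity, fun Q hQ R hR => ?_⟩
  set c : T → ℝ := fun s => Q.coeff s.1 with hc
  have hQc : (fun x : EuclideanSpace ℝ ι => MvPolynomial.eval (fun i => x i) Q) =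
      coeffEval c := by
    funext x
    rw [MvPolynomial.eval_eq', coeffEval, hc,
      Finset.sum_coe_sort T fun s => Q.coeff s * ∏ i, x i ^ s i]
    refine Finset.sum_subset (fun s hs => ?_) fun s _ hs => ?_
    · rw [hTdef, Set.Finite.mem_toFinset]
      exact (MvPolynomial.le_totalDegree hs).trans hQ
    · simp [MvPolynomial.notMem_support_iff.1 hs]
  rw [hQc]
  have hlow : κ * ‖c‖ₑ ≤ eLpNorm (coeffEval c) p
      (volume.restrict (Metric.closedBall (0 : EuclideanSpace ℝ ι) 1)) := by
    by_cases hc0 : c = 0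
    · simp [hc0]
    have hn : ‖c‖ ≠ 0 := norm_ne_zero_iff.2 hc0
    have h1 : c = ‖c‖ • (‖c‖⁻¹ • c) := by rw [smul_inv_smul₀ hn]
    conv_rhs => rw [h1]
    rw [coeffEval_smul, eLpNorm_const_smul, mul_comm, enorm_norm]
    gcongr
    apply hle
    simp [norm_smul, hn]
  refine (eLpNorm_coeffEval_closedBall_le hT p c hR).trans ?_
  rw [← hV]
  calc V * ENNReal.ofReal (R ^ (r + Fintype.card ι * p.toReal⁻¹)) * ‖c‖ₑ
      = V / κ * ENNReal.ofReal (R ^ (r + Fintype.card ι * p.toReal⁻¹)) * (κ * ‖c‖ₑ) := by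
        conv_lhs => rw [← ENNReal.div_mul_cancel (a := κ) (b := V) hκ0.ne' hκ]
        ring
    _ ≤ _ := by
        gcongr
        rw [ENNReal.coe_add, ENNReal.coe_toNNReal hVκ]
        exact le_self_add

lemma MvPolynomial.totalDegree_bind₁_le {σ τ R : Type*} [CommSemiring R]
    (f : σ → MvPolynomial τ R) (hf : ∀ i, (f i).totalDegree ≤ 1) (Q : MvPolynomial σ R) :
    (MvPolynomial.bind₁ f Q).totalDegree ≤ Q.totalDegree := by
  rw [MvPolynomial.bind₁, MvPolynomial.aeval_def, MvPolynomial.eval₂_eq]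
  refine MvPolynomial.totalDegree_finsetSum_le fun s hs => ?_
  refine le_trans ?_ (MvPolynomial.le_totalDegree hs)
  rw [MvPolynomial.algebraMap_eq]
  refine (MvPolynomial.totalDegree_mul _ _).trans ?_
  rw [MvPolynomial.totalDegree_C, zero_add]
  refine (MvPolynomial.totalDegree_finsetProd _ _).trans (Finset.sum_le_sum fun i _ => ?_)
  refine (MvPolynomial.totalDegree_pow _ _).trans ?_
  exact (Nat.mul_le_mul_left _ (hf i)).trans (mul_one _).le

/-- Composition with an affine map does not increase the total degree. -/
lemma exists_eval_comp_affine {ι : Type*} [Fintype ι]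
    (A : EuclideanSpace ℝ ι →ₗ[ℝ] EuclideanSpace ℝ ι) (v : EuclideanSpace ℝ ι)
    (Q : MvPolynomial ι ℝ) : ∃ P : MvPolynomial ι ℝ, P.totalDegree ≤ Q.totalDegree ∧
      ∀ x : EuclideanSpace ℝ ι,
        MvPolynomial.eval (fun i => (A x + v) i) Q = MvPolynomial.eval (fun i => x i) P := by
  classical
  let f : ι → MvPolynomial ι ℝ := fun i =>
    ∑ j, MvPolynomial.C (A (EuclideanSpace.single j 1) i) * MvPolynomial.X j +
      MvPolynomial.C (v i)
  refine ⟨MvPolynomial.bind₁ f Q, MvPolynomial.totalDegree_bind₁_le f (fun i => ?_) Q,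
    fun x => ?_⟩
  · refine (MvPolynomial.totalDegree_add _ _).trans (max_le ?_ (by simp))
    refine MvPolynomial.totalDegree_finsetSum_le fun j _ => ?_
    refine (MvPolynomial.totalDegree_mul _ _).trans ?_
    simp
  · rw [← MvPolynomial.coe_aeval_eq_eval, ← MvPolynomial.coe_aeval_eq_eval]
    simp only [RingHom.coe_coe]
    rw [MvPolynomial.aeval_bind₁]
    congr 2
    funext i
    have hx : x = ∑ j, x j • EuclideanSpace.single j (1 : ℝ) := by
      ext i
      simp [Finset.sum_apply, Pi.single_apply]
    conv_lhs => rw [hx]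
    simp [f, mul_comm]

/-- If `S` contains a nondegenerate affine image of the unit ball and `S'` is contained in the
image of the ball of radius `R` under the same map, then the `L^p` norms of polynomials over `S'`
are controlled by those over `S`. -/
theorem exists_eLpNorm_restrict_le_of_affine {ι : Type*} [Fintype ι] (r : ℕ) {p : ℝ≥0∞}
    (hp : 0 < p) :
    ∃ K : ℝ≥0, 0 < K ∧ ∀ Q : MvPolynomial ι ℝ, Q.totalDegree ≤ r → ∀ R : ℝ, 1 ≤ R →
      ∀ (A : EuclideanSpace ℝ ι →ₗ[ℝ] EuclideanSpace ℝ ι) (v : EuclideanSpace ℝ ι),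
      Function.Injective A → ∀ S S' : Set (EuclideanSpace ℝ ι),
      (∀ u, ‖u‖ ≤ 1 → A u + v ∈ S) → (∀ u, A u + v ∈ S' → ‖u‖ ≤ R) →
      eLpNorm (fun x : EuclideanSpace ℝ ι => MvPolynomial.eval (fun i => x i) Q) p
          (volume.restrict S') ≤
        K * ENNReal.ofReal (R ^ (r + Fintype.card ι * p.toReal⁻¹)) *
          eLpNorm (fun x : EuclideanSpace ℝ ι => MvPolynomial.eval (fun i => x i) Q) p
            (volume.restrict S) := by
  obtain ⟨K, hK, hball⟩ := exists_eLpNorm_closedBall_le (ι := ι) r hp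
  refine ⟨K, hK, fun Q hQ R hR A v hA S S' hS hS' => ?_⟩
  obtain ⟨P, hPdeg, hP⟩ := exists_eval_comp_affine A v Q
  set q := fun x : EuclideanSpace ℝ ι => MvPolynomial.eval (fun i => x i) Q with hq
  set φ : EuclideanSpace ℝ ι → EuclideanSpace ℝ ι := fun u => A u + v with hφ
  have hdet : LinearMap.det A ≠ 0 := by
    rw [Ne, LinearMap.det_eq_zero_iff_ker_ne_bot, not_not]
    exact LinearMap.ker_eq_bot.2 hA
  have hφm : MeasurableEmbedding φ :=
    (measurableEmbedding_addRight v).comp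
      ((LinearMap.isClosedEmbedding_of_injective (LinearMap.ker_eq_bot.2 hA)).measurableEmbedding)
  set a := ENNReal.ofReal |(LinearMap.det A)⁻¹| with ha
  have ha0 : a ≠ 0 := by simpa [ha] using hdet
  have hmap : Measure.map φ volume = a • (volume : Measure (EuclideanSpace ℝ ι)) := by
    have hAm : Measurable A := A.continuous_of_finiteDimensional.measurable
    have h1 : φ = (fun x => x + v) ∘ A := rfl
    rw [h1, ← Measure.map_map (measurable_add_const v) hAm,
      Measure.map_linearMap_addHaar_eq_smul_addHaar _ hdet, Measure.map_smul,
      map_add_right_eq_self]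
  have key : ∀ s : Set (EuclideanSpace ℝ ι), a ^ (1 / p).toReal * eLpNorm q p (volume.restrict s) =
      eLpNorm (fun x : EuclideanSpace ℝ ι => MvPolynomial.eval (fun i => x i) P) p
        (volume.restrict (φ ⁻¹' s)) := by
    intro s
    rw [← smul_eq_mul, ← eLpNorm_smul_measure_of_ne_zero ha0, ← Measure.restrict_smul, ← hmap,
      hφm.restrict_map, hφm.eLpNorm_map_measure]
    congr 1
    funext x
    exact hP x
  have hap0 : a ^ (1 / p).toReal ≠ 0 :=
    (ENNReal.rpow_pos (pos_iff_ne_zero.2 ha0) (by simp [ha])).ne'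
  have hap : a ^ (1 / p).toReal ≠ ∞ :=
    ENNReal.rpow_ne_top_of_nonneg (by positivity) (by simp [ha])
  rw [← ENNReal.mul_le_mul_iff_right hap0 hap, key, mul_left_comm, key]
  have hupper : φ ⁻¹' S' ⊆ Metric.closedBall 0 R :=
    fun u hu => mem_closedBall_zero_iff.2 (hS' u hu)
  have hlower : Metric.closedBall 0 1 ⊆ φ ⁻¹' S :=
    fun u hu => hS u (mem_closedBall_zero_iff.1 hu)
  refine (eLpNorm_mono_measure _ (Measure.restrict_mono hupper le_rfl)).trans
    ((hball P (hPdeg.trans hQ) R hR).trans ?_)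
  gcongr

/-- First order Taylor estimate on a cube in terms of bounds for second partial derivatives. -/
lemma abs_sub_fderiv_le_of_iteratedFDeriv_two {ι : Type*} [Fintype ι] [DecidableEq ι]
    {g : EuclideanSpace ℝ ι → ℝ}
    (hg : ContDiff ℝ 2 g) {s : Set (EuclideanSpace ℝ ι)} (hs : Convex ℝ s) {M : ℝ}
    (hM : ∀ x ∈ s, ∀ i j : ι,
      |iteratedFDeriv ℝ 2 g x ![EuclideanSpace.single i 1, EuclideanSpace.single j 1]| ≤ M)
    {x₀ x : EuclideanSpace ℝ ι} (hx₀ : x₀ ∈ s) (hx : x ∈ s) {ρ : ℝ}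
    (hρ : ∀ i, |x i - x₀ i| ≤ ρ) :
    |g x - g x₀ - fderiv ℝ g x₀ (x - x₀)| ≤ (Fintype.card ι : ℝ) ^ 2 * M * ρ ^ 2 := by
  set v := x - x₀ with hv
  have hγ : ∀ t : ℝ, HasDerivAt (fun t : ℝ => x₀ + t • v) v t := fun t => by
    simpa using ((hasDerivAt_id t).smul_const v).const_add x₀
  have hmem : ∀ t ∈ Set.Icc (0 : ℝ) 1, x₀ + t • v ∈ s := fun t ht =>
    hs.add_smul_sub_mem hx₀ hx ht
  have hB : ∀ t ∈ Set.Icc (0 : ℝ) 1,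
      |fderiv ℝ (fderiv ℝ g) (x₀ + t • v) v v| ≤ (Fintype.card ι : ℝ) ^ 2 * M * ρ ^ 2 := by
    intro t ht
    have hvs : v = ∑ j, v j • EuclideanSpace.single j (1 : ℝ) := by
      ext i
      simp [Finset.sum_apply, Pi.single_apply]
    have hexp : fderiv ℝ (fderiv ℝ g) (x₀ + t • v) v v = ∑ i, ∑ j, v i * (v j *
        fderiv ℝ (fderiv ℝ g) (x₀ + t • v) (EuclideanSpace.single i 1)
          (EuclideanSpace.single j 1)) := by
      generalize fderiv ℝ (fderiv ℝ g) (x₀ + t • v) = D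
      conv_lhs => rw [hvs]
      simp only [map_sum, map_smul, sum_apply, smul_eq_mul,
        smul_apply, Finset.mul_sum]
      rw [Finset.sum_comm]
      exact Finset.sum_congr rfl fun i _ => Finset.sum_congr rfl fun j _ => mul_left_comm _ _ _
    rw [hexp]
    refine (Finset.abs_sum_le_sum_abs _ _).trans ?_
    calc _ ≤ ∑ _i : ι, ∑ _j : ι, ρ * (ρ * M) := by
          refine Finset.sum_le_sum fun i _ => (Finset.abs_sum_le_sum_abs _ _).trans
            (Finset.sum_le_sum fun j _ => ?_)
          have h1 := hM _ (hmem t ht) i j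
          rw [iteratedFDeriv_two_apply] at h1
          simp only [Matrix.cons_val_zero, Matrix.cons_val_one] at h1
          have hρ0 : 0 ≤ ρ := (abs_nonneg _).trans (hρ i)
          rw [abs_mul, abs_mul]
          have hi : |v i| ≤ ρ := hρ i
          have hj : |v j| ≤ ρ := hρ j
          gcongr
      _ = _ := by
          simp
          ring
  have hd1 : Differentiable ℝ g := hg.differentiable (by norm_num)
  have hd2 : Differentiable ℝ (fderiv ℝ g) :=
    (hg.fderiv_right (m := 1) (by norm_num)).differentiable (by norm_num)
  have hφ' : ∀ t : ℝ, HasDerivAt (fun t : ℝ => fderiv ℝ g (x₀ + t • v) v)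
      (fderiv ℝ (fderiv ℝ g) (x₀ + t • v) v v) t := by
    intro t
    have h1 : HasDerivAt (fun t : ℝ => fderiv ℝ g (x₀ + t • v))
        (fderiv ℝ (fderiv ℝ g) (x₀ + t • v) v) t :=
      (hd2 (x₀ + t • v)).hasFDerivAt.comp_hasDerivAt t (hγ t)
    have h2 := h1.clm_apply (hasDerivAt_const t v)
    rwa [map_zero, add_zero] at h2
  have hφ : ∀ t : ℝ, HasDerivAt (fun t : ℝ => g (x₀ + t • v) - t * fderiv ℝ g x₀ v)
      (fderiv ℝ g (x₀ + t • v) v - fderiv ℝ g x₀ v) t := fun t => by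
    have := ((hd1 (x₀ + t • v)).hasFDerivAt.comp_hasDerivAt t (hγ t)).sub
      ((hasDerivAt_id t).mul_const (fderiv ℝ g x₀ v))
    rw [one_mul] at this
    exact this
  set B := (Fintype.card ι : ℝ) ^ 2 * M * ρ ^ 2 with hBdef
  have hB0 : 0 ≤ B := (abs_nonneg _).trans (hB 0 (by simp))
  have hstep : ∀ t ∈ Set.Icc (0 : ℝ) 1, ‖fderiv ℝ g (x₀ + t • v) v - fderiv ℝ g x₀ v‖ ≤ B := by
    intro t ht
    have := (convex_Icc (0 : ℝ) 1).norm_image_sub_le_of_norm_hasDerivWithin_le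
      (fun t _ => (hφ' t).hasDerivWithinAt) hB (x := 0) (y := t) (by simp) ht
    simp only [zero_smul, add_zero, sub_zero] at this
    refine this.trans (mul_le_of_le_one_right hB0 ?_)
    rw [Real.norm_of_nonneg ht.1]
    exact ht.2
  have := (convex_Icc (0 : ℝ) 1).norm_image_sub_le_of_norm_hasDerivWithin_le
      (fun t _ => (hφ t).hasDerivWithinAt) hstep (x := 0) (y := 1) (by simp) (by simp)
  simp only [zero_smul, add_zero, sub_zero, one_smul, norm_one, mul_one, zero_mul, one_mul, hv,
    add_sub_cancel, Real.norm_eq_abs] at this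
  rwa [sub_right_comm] at this

lemma chebPt_sub (α : ℝ) (N j k : ℕ) : chebPt α N k - chebPt α N j =
    2 * α * (Real.sin ((k + j) * (Real.pi / (2 * N))) *
      Real.sin ((k - j) * (Real.pi / (2 * N)))) := by
  rw [chebPt, chebPt, add_mul, sub_mul, Real.sin_add, Real.sin_sub, mul_div_assoc, mul_div_assoc]
  generalize (k : ℝ) * (Real.pi / (2 * N)) = x
  generalize (j : ℝ) * (Real.pi / (2 * N)) = y
  linear_combination 2 * α * (Real.sin x ^ 2 * Real.sin_sq_add_cos_sq y -
    Real.sin y ^ 2 * Real.sin_sq_add_cos_sq x) * (-1)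

lemma half_mul_le_sin {x : ℝ} (h0 : 0 ≤ x) (h1 : x ≤ Real.pi / 2) : x / 2 ≤ Real.sin x := by
  refine le_trans ?_ (Real.mul_le_sin h0 h1)
  rw [div_mul_eq_mul_div, div_le_div_iff₀ two_pos Real.pi_pos]
  nlinarith [Real.pi_le_four]

lemma le_chebPt_succ_sub {ℓ₁ n l : ℕ} (hℓ : 0 < ℓ₁) (hl : l < n) {α : ℝ}
    (hα : α = 1 / (2 * Real.sin (Real.pi / (2 * ℓ₁)) ^ 2)) :
    (2 * l + 1) / (16 * (n : ℝ) ^ 2) ≤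
      chebPt α (2 * ℓ₁ * n) (l + 1) - chebPt α (2 * ℓ₁ * n) l := by
  have hn : (0 : ℝ) < n := by exact_mod_cast (Nat.zero_le l).trans_lt hl
  have hln : (l : ℝ) + 1 ≤ n := by exact_mod_cast hl
  have hℓ1 : (1 : ℝ) ≤ ℓ₁ := by exact_mod_cast hℓ
  have hφ0 : 0 < Real.pi / (2 * ℓ₁) := by positivity
  have hφ1 : Real.pi / (2 * ℓ₁) ≤ Real.pi / 2 := by
    gcongr
    linarith
  have hθ : Real.pi / (2 * ((2 * ℓ₁ * n : ℕ) : ℝ)) = Real.pi / (2 * ℓ₁) / (2 * n) := by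
    push_cast
    field_simp
  rw [chebPt_sub, hθ, hα]
  set φ := Real.pi / (2 * ℓ₁) with hφ
  have hS0 : 0 < Real.sin φ := Real.sin_pos_of_pos_of_lt_pi hφ0 (by linarith [Real.pi_pos])
  have hS : Real.sin φ ≤ φ := Real.sin_le hφ0.le
  have hle : ∀ a : ℝ, 0 ≤ a → a ≤ 2 * n → a * (φ / (2 * n)) / 2 ≤ Real.sin (a * (φ / (2 * n))) := by
    intro a ha han
    refine half_mul_le_sin (by positivity) (le_trans ?_ hφ1)
    rw [mul_div_assoc', div_le_iff₀ (by positivity), mul_comm]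
    gcongr
  have h1 := hle (2 * l + 1) (by positivity) (by linarith)
  have h2 := hle 1 (by positivity) (by linarith)
  have e1 : ((l + 1 : ℕ) : ℝ) + l = 2 * l + 1 := by push_cast; ring
  have e2 : ((l + 1 : ℕ) : ℝ) - l = 1 := by push_cast; ring
  rw [e1, e2]
  calc (2 * l + 1) / (16 * (n : ℝ) ^ 2)
      = 1 / φ ^ 2 * ((2 * l + 1) * (φ / (2 * n)) / 2 * (1 * (φ / (2 * n)) / 2)) := by
        field_simp
        norm_num
    _ ≤ 1 / Real.sin φ ^ 2 * (Real.sin ((2 * l + 1) * (φ / (2 * n))) *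
          Real.sin (1 * (φ / (2 * n)))) := by
        have h3 : 0 ≤ Real.sin ((2 * l + 1) * (φ / (2 * n))) := le_trans (by positivity) h1
        gcongr
    _ = _ := by
        field_simp

lemma chebPt_sub_le {ℓ₁ n j k : ℕ} (hn : 0 < n) (hℓ : 0 < ℓ₁) {α : ℝ}
    (hα : α = 1 / (2 * Real.sin (Real.pi / (2 * ℓ₁)) ^ 2)) :
    |chebPt α (2 * ℓ₁ * n) k - chebPt α (2 * ℓ₁ * n) j| ≤
      (k + j) * |(k : ℝ) - j| / (n : ℝ) ^ 2 := by
  have hn : (0 : ℝ) < n := by exact_mod_cast hn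
  have hℓ1 : (1 : ℝ) ≤ ℓ₁ := by exact_mod_cast hℓ
  have hφ0 : 0 < Real.pi / (2 * ℓ₁) := by positivity
  have hφ1 : Real.pi / (2 * ℓ₁) ≤ Real.pi / 2 := by
    gcongr
    linarith
  have hθ : Real.pi / (2 * ((2 * ℓ₁ * n : ℕ) : ℝ)) = Real.pi / (2 * ℓ₁) / (2 * n) := by
    push_cast
    field_simp
  rw [chebPt_sub, hθ, hα]
  set φ := Real.pi / (2 * ℓ₁) with hφ
  have hS : φ / 2 ≤ Real.sin φ := half_mul_le_sin hφ0.le hφ1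
  have hS0 : 0 < Real.sin φ := lt_of_lt_of_le (by positivity) hS
  have hab : ∀ x : ℝ, |Real.sin x| ≤ |x| := fun x => Real.abs_sin_le_abs
  calc |2 * (1 / (2 * Real.sin φ ^ 2)) * (Real.sin ((k + j) * (φ / (2 * n))) *
          Real.sin ((k - j) * (φ / (2 * n))))|
      = 1 / Real.sin φ ^ 2 * (|Real.sin ((k + j) * (φ / (2 * n)))| *
          |Real.sin ((k - j) * (φ / (2 * n)))|) := by
        rw [abs_mul, abs_mul (Real.sin _),
          abs_of_nonneg (by positivity : 0 ≤ 2 * (1 / (2 * Real.sin φ ^ 2)))]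
        field_simp
    _ ≤ 1 / (φ / 2) ^ 2 * (|(k + j) * (φ / (2 * n))| * |(k - j) * (φ / (2 * n))|) := by
        gcongr ?_ * (?_ * ?_)
        · gcongr
        · exact hab _
        · exact hab _
    _ = _ := by
        rw [abs_mul, abs_mul, abs_of_nonneg (by positivity : (0 : ℝ) ≤ φ / (2 * n)),
          abs_of_nonneg (by positivity : (0 : ℝ) ≤ (k : ℝ) + j)]
        field_simp

lemma xpart_apply {d : ℕ} (ξ : EuclideanSpace ℝ (Fin (d + 1))) (i : Fin d) :
    xpart ξ i = ξ i.castSucc := rfl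

/-- The linear map `(u, w) ↦ (s u, h w + f (s u))`. -/
def shearMap {d : ℕ} (s h : ℝ) (f : EuclideanSpace ℝ (Fin d) →L[ℝ] ℝ) :
    EuclideanSpace ℝ (Fin (d + 1)) →ₗ[ℝ] EuclideanSpace ℝ (Fin (d + 1)) where
  toFun u := WithLp.toLp 2 (Fin.snoc (α := fun _ => ℝ) (fun i : Fin d => s * u i.castSucc)
    (h * u (Fin.last d) + f (s • xpart u)))
  map_add' u v := by
    have hx : xpart (u + v) = xpart u + xpart v := rfl
    ext i
    refine Fin.lastCases ?_ (fun i => ?_) i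
    · simp [hx]
      ring
    · simp
      ring
  map_smul' c u := by
    have hx : xpart (c • u) = c • xpart u := rfl
    ext i
    refine Fin.lastCases ?_ (fun i => ?_) i
    · simp [hx]
      ring
    · simp
      ring

lemma shearMap_castSucc {d : ℕ} (s h : ℝ) (f : EuclideanSpace ℝ (Fin d) →L[ℝ] ℝ)
    (u : EuclideanSpace ℝ (Fin (d + 1))) (i : Fin d) :
    shearMap s h f u i.castSucc = s * u i.castSucc := by
  simp [shearMap]

lemma shearMap_last {d : ℕ} (s h : ℝ) (f : EuclideanSpace ℝ (Fin d) →L[ℝ] ℝ)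
    (u : EuclideanSpace ℝ (Fin (d + 1))) :
    shearMap s h f u (Fin.last d) = h * u (Fin.last d) + f (s • xpart u) := by
  simp [shearMap]

lemma shearMap_injective {d : ℕ} {s h : ℝ} (hs : s ≠ 0) (hh : h ≠ 0)
    (f : EuclideanSpace ℝ (Fin d) →L[ℝ] ℝ) : Function.Injective (shearMap s h f) := by
  rw [injective_iff_map_eq_zero]
  intro u hu
  have hc : ∀ i : Fin d, u i.castSucc = 0 := fun i => by
    have := shearMap_castSucc s h f u i
    rw [hu] at this
    simpa [hs] using this.symm
  have hx : xpart u = 0 := by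
    ext i
    exact hc i
  have hl := shearMap_last s h f u
  rw [hu, hx] at hl
  ext i
  refine Fin.lastCases ?_ hc i
  simpa [hh] using hl.symm

/-- The cell with indices `(i, j)` of the partition attached to the graph of `g`. -/
def graphCell {d : ℕ} (g : EuclideanSpace ℝ (Fin d) → ℝ) (b α : ℝ) (n N : ℕ) (i : Fin d → ℕ)
    (j : ℕ) : Set (EuclideanSpace ℝ (Fin (d + 1))) :=
  {ξ | (∀ m, xpart ξ m ∈ Set.Icc (gridPt b n (i m)) (gridPt b n (i m + 1))) ∧
    g (xpart ξ) - ypart ξ ∈ Set.Icc (chebPt α N j) (chebPt α N (j + 1))}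

lemma gridPt_mem {b : ℝ} (hb : 0 < b) {n i : ℕ} (hn : 0 < n) (hi : i ≤ n) :
    gridPt b n i ∈ Set.Icc (-b) b := by
  have hn' : (0 : ℝ) < n := by exact_mod_cast hn
  have hi' : (i : ℝ) ≤ n := by exact_mod_cast hi
  rw [gridPt]
  constructor
  · have : 0 ≤ 2 * i * b / n := by positivity
    linarith
  · have : 2 * i * b / n ≤ 2 * b := by
      rw [div_le_iff₀ hn']
      nlinarith
    linarith

lemma gridPt_succ (b : ℝ) (n i : ℕ) : gridPt b n (i + 1) = gridPt b n i + 2 * (b / n) := by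
  simp only [gridPt]
  push_cast
  ring

lemma gridPt_sub (b : ℝ) (n i k : ℕ) :
    gridPt b n i - gridPt b n k = 2 * (b / n) * ((i : ℝ) - k) := by
  simp only [gridPt]
  ring

/-- Each point of the cell with last index `j` has height within a controlled multiple of the
height of the cell with last index `l` from the middle of that cell. -/
lemma abs_sub_chebPt_midpoint_le {ℓ₁ n j l : ℕ} (hn : 0 < n) (hℓ : 0 < ℓ₁) {α : ℝ}
    (hα : α = 1 / (2 * Real.sin (Real.pi / (2 * ℓ₁)) ^ 2)) {R : ℝ}
    (hR : |(j : ℝ) - l| + 1 ≤ R) (hw : chebPt α (2 * ℓ₁ * n) l ≤ chebPt α (2 * ℓ₁ * n) (l + 1))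
    {t : ℝ} (ht : t ∈ Set.Icc (chebPt α (2 * ℓ₁ * n) j) (chebPt α (2 * ℓ₁ * n) (j + 1))) :
    |t - (chebPt α (2 * ℓ₁ * n) l + chebPt α (2 * ℓ₁ * n) (l + 1)) / 2| ≤
      (2 * l + 1) * R ^ 2 / (n : ℝ) ^ 2 := by
  have h1 := (le_abs_self _).trans (chebPt_sub_le (j := l) (k := j + 1) hn hℓ hα)
  have h2 := (le_abs_self _).trans (chebPt_sub_le (j := j) (k := l + 1) hn hℓ hα)
  have hl0 : (0 : ℝ) ≤ l := Nat.cast_nonneg l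
  have hj0 : (0 : ℝ) ≤ j := Nat.cast_nonneg j
  have habs := abs_nonneg ((j : ℝ) - l)
  have hR1 : 1 ≤ R := by linarith
  have hjl : (j : ℝ) + l + 1 ≤ (2 * l + 1) * R := by
    nlinarith [le_abs_self ((j : ℝ) - l)]
  have hd1 : |((j + 1 : ℕ) : ℝ) - l| ≤ R := by
    push_cast
    rw [abs_le]
    constructor <;> linarith [neg_abs_le ((j : ℝ) - l), le_abs_self ((j : ℝ) - l)]
  have hd2 : |((l + 1 : ℕ) : ℝ) - j| ≤ R := by
    push_cast
    rw [abs_le]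
    constructor <;> linarith [neg_abs_le ((j : ℝ) - l), le_abs_self ((j : ℝ) - l)]
  have b1 : (((j + 1 : ℕ) : ℝ) + l) * |((j + 1 : ℕ) : ℝ) - l| / (n : ℝ) ^ 2 ≤
      (2 * l + 1) * R ^ 2 / (n : ℝ) ^ 2 := by
    refine div_le_div_of_nonneg_right ?_ (by positivity)
    rw [pow_two, ← mul_assoc]
    refine mul_le_mul ?_ hd1 (abs_nonneg _) (by positivity)
    push_cast
    linarith
  have b2 : (((l + 1 : ℕ) : ℝ) + j) * |((l + 1 : ℕ) : ℝ) - j| / (n : ℝ) ^ 2 ≤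
      (2 * l + 1) * R ^ 2 / (n : ℝ) ^ 2 := by
    refine div_le_div_of_nonneg_right ?_ (by positivity)
    rw [pow_two, ← mul_assoc]
    refine mul_le_mul ?_ hd2 (abs_nonneg _) (by positivity)
    push_cast
    linarith
  rw [abs_le]
  constructor <;> linarith [ht.1, ht.2]

set_option maxHeartbeats 1000000 in
/-- The cell `(k, l)` contains an affine image of the unit ball whose dilate by a factor
polynomial in the distance of the indices contains the cell `(i, j)`. -/
theorem exists_affine_graphCell {d : ℕ} (hd : 0 < d) {b : ℝ} (hb0 : 0 < b)
    (hb : b < 1 / (2 * d)) {g : EuclideanSpace ℝ (Fin d) → ℝ} (hg : ContDiff ℝ 2 g) {M : ℝ}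
    (hM0 : 0 ≤ M)
    (hM : ∀ x : EuclideanSpace ℝ (Fin d), (∀ i, x i ∈ Set.Icc (-b) b) → ∀ i j : Fin d,
      |iteratedFDeriv ℝ 2 g x ![EuclideanSpace.single i 1, EuclideanSpace.single j 1]| ≤ M)
    {n ℓ₁ : ℕ} (hℓ : 0 < ℓ₁) {α : ℝ}
    (hα : α = 1 / (2 * Real.sin (Real.pi / (2 * ℓ₁)) ^ 2))
    {i k : Fin d → ℕ} {j l : ℕ} (hi : ∀ m, i m < n) (hk : ∀ m, k m < n) (hl : l < n)
    {R : ℝ} (hRik : ∀ m, |(i m : ℝ) - k m| + 1 ≤ R) (hRjl : |(j : ℝ) - l| + 1 ≤ R) :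
    ∃ (A : EuclideanSpace ℝ (Fin (d + 1)) →ₗ[ℝ] EuclideanSpace ℝ (Fin (d + 1)))
      (v : EuclideanSpace ℝ (Fin (d + 1))), Function.Injective A ∧
      (∀ u, ‖u‖ ≤ 1 → A u + v ∈ graphCell g b α n (2 * ℓ₁ * n) k l) ∧
      (∀ u, A u + v ∈ graphCell g b α n (2 * ℓ₁ * n) i j →
        ‖u‖ ≤ (d + 1) * (64 * (1 + M) * R ^ 2)) := by
  have hn : 0 < n := (Nat.zero_le l).trans_lt hl
  have hn' : (0 : ℝ) < n := by exact_mod_cast hn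
  have hd' : (0 : ℝ) < d := by exact_mod_cast hd
  have hR1 : 1 ≤ R := by linarith [abs_nonneg ((j : ℝ) - l)]
  have hbn : 0 < b / n := by positivity
  have hdb : d * b ≤ 1 / 2 := by
    rw [lt_div_iff₀ (by positivity)] at hb
    linarith
  have hdb2 : (d : ℝ) ^ 2 * (b / n) ^ 2 ≤ 1 / 4 / (n : ℝ) ^ 2 := by
    rw [div_pow, mul_div_assoc', ← mul_pow]
    gcongr
    nlinarith [mul_pos hd' hb0]
  set a₀ := chebPt α (2 * ℓ₁ * n) l with ha₀
  set a₁ := chebPt α (2 * ℓ₁ * n) (l + 1) with ha₁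
  have hw : (2 * l + 1) / (16 * (n : ℝ) ^ 2) ≤ a₁ - a₀ := le_chebPt_succ_sub hℓ hl hα
  set h := (a₁ - a₀) / 4 with hh
  have hhl : (2 * l + 1) / (n : ℝ) ^ 2 ≤ 64 * h := by
    have e : (2 * l + 1) / (n : ℝ) ^ 2 = 16 * ((2 * l + 1) / (16 * (n : ℝ) ^ 2)) := by
      field_simp
    rw [e, hh]
    linarith
  have hhn : 1 / (n : ℝ) ^ 2 ≤ 64 * h := by
    refine le_trans ?_ hhl
    gcongr
    linarith [Nat.cast_nonneg (α := ℝ) l]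
  have hh0 : 0 < h := by
    have : 0 < 1 / (n : ℝ) ^ 2 := by positivity
    linarith
  set δ := 1 / (16 * (1 + M)) with hδ
  have hδ0 : 0 < δ := by positivity
  have hδM : δ * (1 + M) = 1 / 16 := by
    rw [hδ]
    field_simp
  have hδ1 : δ ≤ 1 / 16 := by nlinarith
  set s := δ * (b / n) with hs
  have hs0 : 0 < s := by positivity
  have hsb : s ≤ b / n := by nlinarith
  set x₀ : EuclideanSpace ℝ (Fin d) := WithLp.toLp 2 fun m => gridPt b n (k m) + b / n with hx₀
  have hx₀m : ∀ m, x₀ m = gridPt b n (k m) + b / n := fun m => rfl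
  set box : Set (EuclideanSpace ℝ (Fin d)) := {x | ∀ m, x m ∈ Set.Icc (-b) b} with hbox
  have hconv : Convex ℝ box := by
    intro x hx y hy p q hp hq hpq m
    exact convex_Icc (-b) b (hx m) (hy m) hp hq hpq
  have hcellbox : ∀ {i : Fin d → ℕ}, (∀ m, i m < n) → ∀ x : EuclideanSpace ℝ (Fin d),
      (∀ m, x m ∈ Set.Icc (gridPt b n (i m)) (gridPt b n (i m + 1))) → x ∈ box := by
    intro i hi x hx m
    exact ⟨(gridPt_mem hb0 hn (hi m).le).1.trans (hx m).1,
      (hx m).2.trans (gridPt_mem hb0 hn (hi m)).2⟩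
  have hx₀box : x₀ ∈ box := hcellbox hk x₀ fun m => by
    rw [hx₀m, gridPt_succ]
    constructor <;> linarith
  have hTaylor : ∀ x ∈ box, ∀ c : ℝ, (∀ m, |x m - x₀ m| ≤ c * (b / n)) →
      |g x - g x₀ - fderiv ℝ g x₀ (x - x₀)| ≤ M * c ^ 2 * (16 * h) := by
    intro x hx c hc
    refine (abs_sub_fderiv_le_of_iteratedFDeriv_two hg hconv hM hx₀box hx hc).trans ?_
    rw [Fintype.card_fin]
    calc (d : ℝ) ^ 2 * M * (c * (b / n)) ^ 2 = M * c ^ 2 * (d ^ 2 * (b / n) ^ 2) := by ring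
      _ ≤ M * c ^ 2 * (16 * h) := by
        refine mul_le_mul_of_nonneg_left (hdb2.trans ?_) (by positivity)
        rw [div_right_comm]
        linarith
  set f := fderiv ℝ g x₀ with hf
  set v : EuclideanSpace ℝ (Fin (d + 1)) := WithLp.toLp 2
    (Fin.snoc (α := fun _ => ℝ) (fun m => x₀ m) (g x₀ - (a₀ + a₁) / 2)) with hv
  have hvx : ∀ m : Fin d, v m.castSucc = x₀ m := fun m => by simp [hv]
  have hvy : v (Fin.last d) = g x₀ - (a₀ + a₁) / 2 := by simp [hv]
  have hX : ∀ u, xpart (shearMap s h f u + v) = x₀ + s • xpart u := by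
    intro u
    ext m
    rw [xpart_apply, PiLp.add_apply, shearMap_castSucc, hvx, PiLp.add_apply, PiLp.smul_apply,
      xpart_apply, smul_eq_mul, add_comm]
  have hXm : ∀ (u : EuclideanSpace ℝ (Fin (d + 1))) (m : Fin d),
      (x₀ + s • xpart u) m - x₀ m = s * u m.castSucc := by
    intro u m
    simp [xpart_apply]
  have hY : ∀ u, g (x₀ + s • xpart u) - ypart (shearMap s h f u + v) =
      (g (x₀ + s • xpart u) - g x₀ - f (x₀ + s • xpart u - x₀)) + (a₀ + a₁) / 2 -
        h * u (Fin.last d) := by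
    intro u
    rw [ypart, PiLp.add_apply, shearMap_last, hvy, add_sub_cancel_left]
    ring
  refine ⟨shearMap s h f, v, shearMap_injective hs0.ne' hh0.ne' f, fun u hu => ?_, fun u hu => ?_⟩
  · have hcoord : ∀ m, |u m| ≤ 1 := fun m => (PiLp.norm_apply_le u m).trans hu
    have hsu : ∀ m : Fin d, |(x₀ + s • xpart u) m - x₀ m| ≤ s := by
      intro m
      rw [hXm, abs_mul, abs_of_pos hs0]
      exact mul_le_of_le_one_right hs0.le (hcoord _)
    have hgrid : ∀ m, (x₀ + s • xpart u) m ∈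
        Set.Icc (gridPt b n (k m)) (gridPt b n (k m + 1)) := by
      intro m
      have h1 := abs_le.1 ((hsu m).trans hsb)
      rw [hx₀m] at h1
      rw [gridPt_succ]
      constructor <;> linarith [h1.1, h1.2]
    have hT := hTaylor _ (hcellbox hk _ hgrid) δ hsu
    have hδh : M * δ ^ 2 * (16 * h) ≤ h := by
      have : M * δ ^ 2 ≤ 1 / 16 := by nlinarith
      nlinarith
    have hu1 : |h * u (Fin.last d)| ≤ h := by
      rw [abs_mul, abs_of_pos hh0]
      exact mul_le_of_le_one_right hh0.le (hcoord _)
    rw [graphCell, Set.mem_ofPred_eq, hX, hY]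
    refine ⟨hgrid, ?_⟩
    rw [abs_le] at hT hu1
    constructor <;> linarith [hT.1, hT.2, hu1.1, hu1.2]
  · rw [graphCell, Set.mem_ofPred_eq, hX] at hu
    obtain ⟨hgrid, hy⟩ := hu
    have hsu : ∀ m : Fin d, |(x₀ + s • xpart u) m - x₀ m| ≤ 2 * R * (b / n) := by
      intro m
      have h1 := hgrid m
      rw [gridPt_succ] at h1
      have h2 := gridPt_sub b n (i m) (k m)
      have h3 := hRik m
      have h4 : |gridPt b n (i m) - gridPt b n (k m)| ≤ 2 * (b / n) * (R - 1) := by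
        rw [h2, abs_mul, abs_of_pos (by positivity)]
        gcongr
        linarith
      have e : 2 * (b / n) * (R - 1) = 2 * R * (b / n) - 2 * (b / n) := by ring
      rw [e, abs_le] at h4
      rw [hx₀m, abs_le]
      constructor <;> linarith [h1.1, h1.2, h4.1, h4.2]
    have hT := hTaylor _ (hcellbox hi _ hgrid) (2 * R) hsu
    have hmid := abs_sub_chebPt_midpoint_le hn hℓ hα hRjl (by linarith) hy
    rw [hY] at hmid
    have hbound : 0 ≤ 64 * (1 + M) * R ^ 2 := by positivity
    have hcoord : ∀ m, |u m| ≤ 64 * (1 + M) * R ^ 2 := by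
      refine fun m => Fin.lastCases ?_ (fun m => ?_) m
      · have hlast : |h * u (Fin.last d)| ≤ h * (64 * (1 + M) * R ^ 2) := by
          have hb : (2 * l + 1) * R ^ 2 / (n : ℝ) ^ 2 ≤ 64 * h * R ^ 2 := by
            rw [mul_div_right_comm]
            gcongr
          have e : M * (2 * R) ^ 2 * (16 * h) + 64 * h * R ^ 2 =
              h * (64 * (1 + M) * R ^ 2) := by ring
          rw [← e]
          rw [abs_le] at hT hmid ⊢
          constructor <;> linarith [hT.1, hT.2, hmid.1, hmid.2]
        rw [abs_mul, abs_of_pos hh0] at hlast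
        exact le_of_mul_le_mul_left hlast hh0
      · have h1 := hsu m
        rw [hXm, abs_mul, abs_of_pos hs0, hs, mul_right_comm] at h1
        have h2 := le_of_mul_le_mul_right h1 hbn
        refine le_of_mul_le_mul_left (h2.trans ?_) hδ0
        have h3 : δ * (64 * (1 + M) * R ^ 2) = 4 * R ^ 2 := by
          linear_combination 64 * R ^ 2 * hδM
        rw [h3]
        nlinarith
    have := EuclideanSpace.norm_le_card_mul u hbound hcoord
    simpa using this

/-- Lemma `lem-5-2`, Dai–Prymak.
Doubling-type comparison of `L^p` norms of a fixed polynomial of total degree `≤ r` on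
different cells `I_{i,j}` of the partition of a domain of special type. -/
theorem statement14 (d : ℕ) (hd : 0 < d) (p : ℝ≥0∞) (hp : 0 < p) (r : ℕ) (hr : 0 < r) :
    ∃ ℓ : ℝ, 0 < ℓ ∧ ∃ C : ℝ → ℝ≥0, (∀ M, 0 < C M) ∧
      ∀ b : ℝ, 0 < b → b < 1 / (2 * d) →
      ∀ g : EuclideanSpace ℝ (Fin d) → ℝ, ContDiff ℝ 2 g →
      ∀ M : ℝ, (∀ x : EuclideanSpace ℝ (Fin d), (∀ i, x i ∈ Set.Icc (-b) b) →
        ∀ i j : Fin d,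
          |iteratedFDeriv ℝ 2 g x ![EuclideanSpace.single i 1, EuclideanSpace.single j 1]|
            ≤ M) →
      ∀ n : ℕ, 0 < n → ∀ ℓ₁ : ℕ, 0 < ℓ₁ →
      ∀ α : ℝ, α = 1 / (2 * Real.sin (Real.pi / (2 * ℓ₁)) ^ 2) →
      ∀ I : (Fin d → Fin n) × Fin n → Set (EuclideanSpace ℝ (Fin (d + 1))),
        (∀ ij, I ij = {ξ |
          (∀ m', xpart ξ m' ∈ Set.Icc (gridPt b n (ij.1 m')) (gridPt b n (ij.1 m' + 1))) ∧
          g (xpart ξ) - ypart ξ ∈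
            Set.Icc (chebPt α (2 * ℓ₁ * n) ij.2) (chebPt α (2 * ℓ₁ * n) (ij.2 + 1))}) →
      ∀ ij kl : (Fin d → Fin n) × Fin n,
      ∀ Q : MvPolynomial (Fin (d + 1)) ℝ, Q.totalDegree ≤ r →
        eLpNorm (fun ξ : EuclideanSpace ℝ (Fin (d + 1)) =>
            MvPolynomial.eval (fun i => ξ i) Q) p (volume.restrict (I ij)) ≤
          (C M : ℝ≥0∞) * ENNReal.ofReal
            ((1 + max (⨆ m' : Fin d, |((ij.1 m' : ℕ) : ℝ) - ((kl.1 m' : ℕ) : ℝ)|)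
                |((ij.2 : ℕ) : ℝ) - ((kl.2 : ℕ) : ℝ)|) ^ ℓ) *
            eLpNorm (fun ξ : EuclideanSpace ℝ (Fin (d + 1)) =>
              MvPolynomial.eval (fun i => ξ i) Q) p (volume.restrict (I kl)) := by
  have hs0 : (0 : ℝ) < r + (d + 1 : ℕ) * p.toReal⁻¹ := by
    have : (0 : ℝ) < r := by exact_mod_cast hr
    positivity
  obtain ⟨K, hK, hnorm⟩ := exists_eLpNorm_restrict_le_of_affine (ι := Fin (d + 1)) r hp
  rw [Fintype.card_fin] at hnorm
  set e : ℝ := r + (d + 1 : ℕ) * p.toReal⁻¹ with he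
  refine ⟨2 * e, by positivity,
    fun M => K * (((d + 1) * (64 * (1 + |M|))) ^ e : ℝ).toNNReal, fun M => ?_, ?_⟩
  · exact mul_pos hK (Real.toNNReal_pos.2 (by positivity))
  intro b hb0 hb g hg M hM n hn ℓ₁ hℓ α hα I hI ij kl Q hQ
  have hM0 : 0 ≤ M := (abs_nonneg _).trans
    (hM 0 (fun i => by simp [hb0.le]) ⟨0, hd⟩ ⟨0, hd⟩)
  set R := 1 + max (⨆ m' : Fin d, |((ij.1 m' : ℕ) : ℝ) - ((kl.1 m' : ℕ) : ℝ)|)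
    |((ij.2 : ℕ) : ℝ) - ((kl.2 : ℕ) : ℝ)| with hR
  have hRjl : |((ij.2 : ℕ) : ℝ) - ((kl.2 : ℕ) : ℝ)| + 1 ≤ R := by
    rw [hR, add_comm]
    gcongr
    exact le_max_right _ _
  have hRik : ∀ m, |((ij.1 m : ℕ) : ℝ) - ((kl.1 m : ℕ) : ℝ)| + 1 ≤ R := fun m => by
    rw [hR, add_comm]
    gcongr
    exact (le_ciSup (f := fun m' : Fin d => |((ij.1 m' : ℕ) : ℝ) - ((kl.1 m' : ℕ) : ℝ)|)
      (Set.finite_range _).bddAbove m).trans (le_max_left _ _)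
  have hR1 : 1 ≤ R := by linarith [abs_nonneg (((ij.2 : ℕ) : ℝ) - ((kl.2 : ℕ) : ℝ))]
  obtain ⟨A, v, hA, hS, hS'⟩ := exists_affine_graphCell hd hb0 hb hg hM0 hM hℓ hα
    (i := fun m => ij.1 m) (k := fun m => kl.1 m) (j := ij.2) (l := kl.2)
    (fun m => (ij.1 m).isLt) (fun m => (kl.1 m).isLt) kl.2.isLt hRik hRjl
  have hR2 : 1 ≤ R ^ 2 := one_le_pow₀ hR1
  have hfac : 1 ≤ ((d : ℝ) + 1) * (64 * (1 + M) * R ^ 2) := by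
    have h1 : 1 ≤ 64 * (1 + M) * R ^ 2 := one_le_mul_of_one_le_of_one_le (by linarith) hR2
    exact one_le_mul_of_one_le_of_one_le (by linarith [Nat.cast_nonneg (α := ℝ) d]) h1
  rw [hI ij, hI kl]
  refine (hnorm Q hQ _ hfac A v hA _ _ hS hS').trans (le_of_eq ?_)
  have hsplit : (((d : ℝ) + 1) * (64 * (1 + M) * R ^ 2)) ^ e =
      ((d + 1) * (64 * (1 + |M|))) ^ e * R ^ (2 * e) := by
    rw [abs_of_nonneg hM0, ← mul_assoc, Real.mul_rpow (by positivity) (by positivity),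
      ← Real.rpow_natCast_mul (by positivity)]
    norm_cast
  rw [hsplit, ENNReal.ofReal_mul (by positivity), ENNReal.coe_mul, ← mul_assoc]
  rfl
end
end

section
/- Let d ≥ 1, a ≥ 1, and let g ∈ C²([−2a,2a]^d) satisfy g(x) ≥ 4a on [−2a,2a]^d; let M > 10 satisfy max_{1≤i≤j≤d} ‖∂_i∂_j g‖_{L^∞([−2a,2a]^d)} ≤ M and ‖∇g(0)‖ ≤ M. Let G := {(x,y) : x ∈ (−a,a)^d, g(x) − a < y ≤ g(x)} and, for λ ∈ (1,2], G(λ) := {(x,y) : x ∈ (−λa, λa)^d, g(x) − λa < y ≤ g(x)}. For a direction ξ ∈ S^{d−1} define D̃_ξ^r f(x,y) := (((ξ, ∂_ξ g(x)))·∇)^r f(x,y), the r-th directional derivative of f along the (non-unit) tangent vector (ξ, ∂_ξ g(x)) ∈ ℝ^{d+1} with x frozen, where ∂_ξ g(x) = ξ·∇g(x). Then for every 0 < p ≤ ∞, λ ∈ (1,2], r ∈ ℕ and every polynomial f ∈ Π_n^{d+1}: max_{ξ∈S^{d−1}} ‖D̃_ξ^r f‖_{L^p(G)} ≤ c · n^r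 · ‖f‖_{L^p(G(λ))}, where c depends only on M, d, λ, r and p. -/
open MeasureTheory ENNReal NNReal

noncomputable section

/-- the cube `[-c,c]^d` -/
def cube (d : ℕ) (c : ℝ) : Set (EuclideanSpace ℝ (Fin d)) :=
  {x | ∀ i, x i ∈ Set.Icc (-c) c}

/-- the directional-derivative operator `v·∇` on polynomials -/
def dirOp {m : ℕ} (v : Fin m → ℝ) (P : MvPolynomial (Fin m) ℝ) : MvPolynomial (Fin m) ℝ :=
  ∑ i, v i • MvPolynomial.pderiv i P

open Complex in
/-- On the closed unit disc a linear factor `z - α` is dominated by `c (1 - β z)` with `‖β‖ ≤ 1`,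
with equality of norms on the unit circle. -/
theorem exists_outer_linear (α : ℂ) : ∃ (c : ℝ) (β : ℂ), 0 ≤ c ∧ ‖β‖ ≤ 1 ∧
    (∀ z : ℂ, ‖z‖ ≤ 1 → ‖z - α‖ ≤ c * ‖1 - β * z‖) ∧
    (∀ z : ℂ, ‖z‖ = 1 → ‖z - α‖ = c * ‖1 - β * z‖) := by
  by_cases hα : ‖α‖ ≤ 1
  · have key : ∀ z : ℂ, ‖1 - (starRingEnd ℂ) α * z‖ ^ 2 - ‖z - α‖ ^ 2 =
        (1 - ‖z‖ ^ 2) * (1 - ‖α‖ ^ 2) := by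
      intro z
      simp only [← Complex.normSq_eq_norm_sq, Complex.normSq_apply]
      simp
      ring
    refine ⟨1, (starRingEnd ℂ) α, zero_le_one, by simpa using hα, fun z hz => ?_, fun z hz => ?_⟩
    · rw [one_mul, ← sq_le_sq₀ (norm_nonneg _) (norm_nonneg _)]
      have h1 : ‖z‖ ^ 2 ≤ 1 := pow_le_one₀ (norm_nonneg _) hz
      have h2 : ‖α‖ ^ 2 ≤ 1 := pow_le_one₀ (norm_nonneg _) hα
      nlinarith [key z]
    · rw [one_mul]
      have := key z
      rw [hz] at this
      exact (sq_eq_sq₀ (norm_nonneg _) (norm_nonneg _)).1 (by linarith)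
  · have hα₁ : 1 < ‖α‖ := not_le.1 hα
    have h0 : α ≠ 0 := by
      rintro rfl
      simp at hα
    have key : ∀ z : ℂ, ‖z - α‖ = ‖α‖ * ‖1 - α⁻¹ * z‖ := by
      intro z
      rw [← norm_mul, mul_sub, mul_inv_cancel_left₀ h0, mul_one, norm_sub_rev]
    exact ⟨‖α‖, α⁻¹, norm_nonneg _, by rw [norm_inv]; exact inv_le_one_of_one_le₀ hα₁.le,
      fun z _ => (key z).le, fun z _ => key z⟩

open Complex Metric in
/-- `z ↦ (1 - β z) ^ p` is analytic in the open unit disc and continuous up to the boundary. -/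
theorem diffContOnCl_one_sub_cpow {p : ℝ} (hp : 0 < p) {β : ℂ} (hβ : ‖β‖ ≤ 1) :
    DiffContOnCl ℂ (fun z : ℂ => (1 - β * z) ^ (p : ℂ)) (ball 0 1) := by
  have hre : ∀ z : ℂ, (β * z).re ≤ ‖z‖ := fun z =>
    (re_le_norm _).trans (by
      rw [norm_mul]
      exact mul_le_of_le_one_left (norm_nonneg _) hβ)
  refine ⟨fun z hz => ?_, fun z hz => ?_⟩
  · refine DifferentiableAt.differentiableWithinAt ?_
    refine DifferentiableAt.cpow (by fun_prop) (by fun_prop) (Or.inl ?_)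
    have hz' : ‖z‖ < 1 := by simpa using hz
    simp only [sub_re, one_re]
    linarith [hre z]
  · refine ContinuousAt.continuousWithinAt ?_
    have hz' : ‖z‖ ≤ 1 := by
      rw [closure_ball _ one_ne_zero] at hz
      simpa using hz
    have h := continuousAt_cpow_const_of_re_pos (z := 1 - β * z) (w := (p : ℂ))
      (Or.inl (by simp only [sub_re, one_re]; linarith [hre z])) (by simpa using hp)
    exact ContinuousAt.comp (f := fun z : ℂ => 1 - β * z) h (by fun_prop)

open Complex Metric in
/-- The `p`-th power of the modulus of a polynomial is dominated in the unit disc, and attained on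
the unit circle, by the modulus of a function analytic in the disc. -/
theorem exists_diffContOnCl_norm_rpow {p : ℝ} (hp : 0 < p) (Q : Polynomial ℂ) :
    ∃ h : ℂ → ℂ, DiffContOnCl ℂ h (ball 0 1) ∧
      (∀ z : ℂ, ‖z‖ ≤ 1 → ‖Q.eval z‖ ^ p ≤ ‖h z‖) ∧
      (∀ z : ℂ, ‖z‖ = 1 → ‖Q.eval z‖ ^ p = ‖h z‖) := by
  have hprod : ∀ s : Multiset ℂ, ∃ h : ℂ → ℂ, DiffContOnCl ℂ h (ball 0 1) ∧
      (∀ z : ℂ, ‖z‖ ≤ 1 →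
        ‖(s.map fun a => Polynomial.X - Polynomial.C a).prod.eval z‖ ^ p ≤ ‖h z‖) ∧
      (∀ z : ℂ, ‖z‖ = 1 →
        ‖(s.map fun a => Polynomial.X - Polynomial.C a).prod.eval z‖ ^ p = ‖h z‖) := by
    intro s
    induction s using Multiset.induction with
    | empty => exact ⟨fun _ => 1, diffContOnCl_const, by simp, by simp⟩
    | cons α s ih =>
      obtain ⟨h, hd, h1, h2⟩ := ih
      obtain ⟨c, β, hc, hβ, k1, k2⟩ := exists_outer_linear α
      have hn : ∀ z : ℂ, ‖((c ^ p : ℝ) : ℂ) * (1 - β * z) ^ (p : ℂ) * h z‖ =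
          (c * ‖1 - β * z‖) ^ p * ‖h z‖ := by
        intro z
        rw [norm_mul, norm_mul, norm_cpow_real, Complex.norm_real, Real.norm_of_nonneg (by positivity),
          Real.mul_rpow hc (norm_nonneg _)]
      refine ⟨fun z => ((c ^ p : ℝ) : ℂ) * (1 - β * z) ^ (p : ℂ) * h z, ?_, ?_, ?_⟩
      · have := (diffContOnCl_one_sub_cpow hp hβ).const_smul ((c ^ p : ℝ) : ℂ)
        exact this.smul hd
      · intro z hz
        rw [hn, Multiset.map_cons, Multiset.prod_cons, Polynomial.eval_mul, norm_mul,
          Real.mul_rpow (norm_nonneg _) (norm_nonneg _)]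
        gcongr
        · simpa using k1 z hz
        · exact h1 z hz
      · intro z hz
        rw [hn, Multiset.map_cons, Multiset.prod_cons, Polynomial.eval_mul, norm_mul,
          Real.mul_rpow (norm_nonneg _) (norm_nonneg _), h2 z hz, ← k2 z hz]
        simp
  obtain ⟨h, hd, h1, h2⟩ := hprod Q.roots
  have hQ := (IsAlgClosed.splits Q).eq_prod_roots
  have hn : ∀ z, ‖Q.eval z‖ ^ p = ‖Q.leadingCoeff‖ ^ p *
      ‖(Q.roots.map fun a => Polynomial.X - Polynomial.C a).prod.eval z‖ ^ p := by
    intro z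
    conv_lhs => rw [hQ]
    rw [Polynomial.eval_mul, norm_mul, Real.mul_rpow (norm_nonneg _) (norm_nonneg _),
      Polynomial.eval_C]
  have hk : ∀ z, ‖((‖Q.leadingCoeff‖ ^ p : ℝ) : ℂ) * h z‖ = ‖Q.leadingCoeff‖ ^ p * ‖h z‖ := by
    intro z
    rw [norm_mul, Complex.norm_real, Real.norm_of_nonneg (by positivity)]
  refine ⟨fun z => ((‖Q.leadingCoeff‖ ^ p : ℝ) : ℂ) * h z,
    hd.const_smul ((‖Q.leadingCoeff‖ ^ p : ℝ) : ℂ), ?_, ?_⟩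
  · intro z hz
    rw [hn, hk]
    gcongr
    exact h1 z hz
  · intro z hz
    rw [hn, hk, h2 z hz]

/-- The density, in the angular variable, of the harmonic measure of the unit circle seen from the
point `w`. -/
def harmonicDensity (w : ℂ) (θ : ℝ) : ℝ :=
  (2 * Real.pi)⁻¹ * poissonKernel 0 w (circleMap 0 1 θ)

/-- The harmonic measure of the unit circle seen from `w`, in the angular variable. -/
def harmonicMeasure (w : ℂ) : Measure ℝ :=
  (volume.restrict (Set.Ioc 0 (2 * Real.pi))).withDensity
    fun θ => ENNReal.ofReal (harmonicDensity w θ)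

theorem harmonicDensity_eq (w : ℂ) (θ : ℝ) : harmonicDensity w θ =
    (2 * Real.pi)⁻¹ * ((1 - ‖w‖ ^ 2) / ‖circleMap 0 1 θ - w‖ ^ 2) := by
  simp [harmonicDensity, poissonKernel_def]

theorem harmonicDensity_nonneg {w : ℂ} (hw : ‖w‖ < 1) (θ : ℝ) : 0 ≤ harmonicDensity w θ := by
  rw [harmonicDensity_eq]
  have : ‖w‖ ^ 2 ≤ 1 := pow_le_one₀ (norm_nonneg _) hw.le
  have : 0 ≤ 1 - ‖w‖ ^ 2 := by linarith
  positivity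

theorem circleMap_sub_ne_zero {w : ℂ} (hw : ‖w‖ < 1) (θ : ℝ) : circleMap 0 1 θ - w ≠ 0 := by
  intro h
  have h1 : ‖circleMap 0 1 θ‖ = 1 := by simp
  rw [sub_eq_zero.1 h] at h1
  linarith

theorem continuous_harmonicDensity {w : ℂ} (hw : ‖w‖ < 1) : Continuous (harmonicDensity w) := by
  have : harmonicDensity w = fun θ =>
      (2 * Real.pi)⁻¹ * ((1 - ‖w‖ ^ 2) / ‖circleMap 0 1 θ - w‖ ^ 2) :=
    funext (harmonicDensity_eq w)
  rw [this]
  refine continuous_const.mul (continuous_const.div (by fun_prop) fun θ => ?_)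
  exact pow_ne_zero _ (norm_ne_zero_iff.2 (circleMap_sub_ne_zero hw θ))

theorem lintegral_harmonicMeasure {w : ℂ} (hw : ‖w‖ < 1) {f : ℝ → ℝ} (hf : Continuous f)
    (hf0 : ∀ θ, 0 ≤ f θ) :
    ∫⁻ θ, ENNReal.ofReal (f θ) ∂harmonicMeasure w =
      ENNReal.ofReal (∫ θ in (0 : ℝ)..2 * Real.pi, harmonicDensity w θ * f θ) := by
  have hc := continuous_harmonicDensity hw
  rw [harmonicMeasure, lintegral_withDensity_eq_lintegral_mul _ (by fun_prop) (by fun_prop),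
    intervalIntegral.integral_of_le (by positivity),
    ofReal_integral_eq_lintegral_ofReal]
  · refine lintegral_congr fun θ => ?_
    simp only [Pi.mul_apply]
    rw [ENNReal.ofReal_mul (harmonicDensity_nonneg hw θ)]
  · exact ((hc.mul hf).integrableOn_Icc (a := 0) (b := 2 * Real.pi)).mono_set Set.Ioc_subset_Icc_self
  · exact Filter.Eventually.of_forall fun θ => mul_nonneg (harmonicDensity_nonneg hw θ) (hf0 θ)

theorem integral_harmonicDensity_smul {w : ℂ} (hw : ‖w‖ < 1) {h : ℂ → ℂ}
    (hd : DiffContOnCl ℂ h (Metric.ball 0 1)) :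
    ∫ θ in (0 : ℝ)..2 * Real.pi, (harmonicDensity w θ : ℂ) * h (circleMap 0 1 θ) = h w := by
  have := hd.circleAverage_poissonKernel_smul (w := w) (by simpa using hw)
  rw [← this, Real.circleAverage_def, ← intervalIntegral.integral_smul]
  refine intervalIntegral.integral_congr fun θ _ => ?_
  simp [harmonicDensity, mul_assoc]

theorem isProbabilityMeasure_harmonicMeasure {w : ℂ} (hw : ‖w‖ < 1) :
    IsProbabilityMeasure (harmonicMeasure w) := by
  constructor
  have h1 := lintegral_harmonicMeasure hw (f := fun _ => 1) continuous_const (by simp)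
  have h2 := integral_harmonicDensity_smul hw (h := fun _ => 1) diffContOnCl_const
  simp only [mul_one, ENNReal.ofReal_one, lintegral_one] at h1 h2
  rw [h1]
  have h3 : ∫ θ in (0 : ℝ)..2 * Real.pi, harmonicDensity w θ = 1 := by
    have : ((∫ θ in (0 : ℝ)..2 * Real.pi, harmonicDensity w θ : ℝ) : ℂ) = 1 := by
      rw [← h2, intervalIntegral.integral_ofReal]
    exact_mod_cast this
  simp [h3]

/-- The sub-mean value property of `‖Q‖ ^ p` with respect to harmonic measure, for every
exponent `p > 0`. -/
theorem enorm_eval_rpow_le_lintegral {p : ℝ} (hp : 0 < p) (Q : Polynomial ℂ) {w : ℂ}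
    (hw : ‖w‖ < 1) :
    ‖Q.eval w‖ₑ ^ p ≤ ∫⁻ θ, ‖Q.eval (circleMap 0 1 θ)‖ₑ ^ p ∂harmonicMeasure w := by
  obtain ⟨h, hd, h1, h2⟩ := exists_diffContOnCl_norm_rpow hp Q
  have e : ∀ z : ℂ, ‖Q.eval z‖ₑ ^ p = ENNReal.ofReal (‖Q.eval z‖ ^ p) := fun z => by
    rw [← ENNReal.ofReal_rpow_of_nonneg (norm_nonneg _) hp.le, ofReal_norm]
  simp only [e]
  have hcont : Continuous fun θ : ℝ => ‖Q.eval (circleMap 0 1 θ)‖ ^ p :=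
    (Q.continuous.comp (continuous_circleMap 0 1)).norm.rpow_const fun _ => Or.inr hp.le
  rw [lintegral_harmonicMeasure hw hcont (fun θ => by positivity)]
  refine ENNReal.ofReal_le_ofReal ((h1 w hw.le).trans ?_)
  rw [← integral_harmonicDensity_smul hw hd]
  refine (intervalIntegral.norm_integral_le_integral_norm (by positivity)).trans_eq ?_
  refine intervalIntegral.integral_congr fun θ _ => ?_
  simp only [norm_mul, Complex.norm_real, Real.norm_of_nonneg (harmonicDensity_nonneg hw θ)]
  rw [h2 _ (by simp)]

/-- Harnack: from points at distance `1/2` the harmonic measure is at most three times the uniform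
measure. -/
theorem lintegral_harmonicMeasure_le {w : ℂ} (hw : ‖w‖ = 1 / 2) (f : ℝ → ℝ≥0∞) :
    ∫⁻ θ, f θ ∂harmonicMeasure w ≤ 3 * ∫⁻ θ, f θ ∂harmonicMeasure 0 := by
  have hle : harmonicMeasure w ≤ (3 : ℝ≥0∞) • harmonicMeasure 0 := by
    rw [harmonicMeasure, harmonicMeasure, ← withDensity_smul' _ _ (by simp)]
    refine withDensity_mono (Filter.Eventually.of_forall fun θ => ?_)
    have h3 : (3 : ℝ≥0∞) = ENNReal.ofReal 3 := by simp
    simp only [Pi.smul_apply, smul_eq_mul]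
    rw [h3, ← ENNReal.ofReal_mul (by norm_num)]
    refine ENNReal.ofReal_le_ofReal ?_
    rw [harmonicDensity_eq, harmonicDensity_eq, hw]
    have hd : 1 / 2 ≤ ‖circleMap 0 1 θ - w‖ := by
      have := norm_sub_norm_le (circleMap 0 1 θ) w
      rw [hw] at this
      simp at this
      linarith
    have h4 : 1 / 4 ≤ ‖circleMap 0 1 θ - w‖ ^ 2 := by nlinarith
    have h5 : (1 - (1 / 2) ^ 2) / ‖circleMap 0 1 θ - w‖ ^ 2 ≤ 3 := by
      rw [div_le_iff₀ (by linarith)]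
      linarith
    have h6 : (1 - ‖(0 : ℂ)‖ ^ 2) / ‖circleMap 0 1 θ - 0‖ ^ 2 = 1 := by simp
    rw [h6]
    have : 0 ≤ (2 * Real.pi)⁻¹ := by positivity
    nlinarith
  calc ∫⁻ θ, f θ ∂harmonicMeasure w ≤ ∫⁻ θ, f θ ∂((3 : ℝ≥0∞) • harmonicMeasure 0) :=
        lintegral_mono' hle le_rfl
    _ = _ := by rw [lintegral_smul_measure, smul_eq_mul]

theorem iteratedDeriv_polynomial_eval (F : Polynomial ℂ) (r : ℕ) :
    iteratedDeriv r (fun z => F.eval z) = fun z => (Polynomial.derivative^[r] F).eval z := by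
  induction r with
  | zero => simp
  | succ k ih =>
    rw [iteratedDeriv_succ, ih]
    ext z
    rw [Polynomial.deriv, Function.iterate_succ_apply']

/-- Coefficients of a polynomial are controlled by its `L^p` size on the unit circle, uniformly in
the degree, for every `p > 0`. -/
theorem enorm_coeff_rpow_le_lintegral {p : ℝ} (hp : 0 < p) (F : Polynomial ℂ) (r : ℕ) :
    ‖F.coeff r‖ₑ ^ p ≤ 3 * ((2 : ℝ≥0∞) ^ r) ^ p *
      ∫⁻ θ, ‖F.eval (circleMap 0 1 θ)‖ₑ ^ p ∂harmonicMeasure 0 := by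
  have hpt : ∀ z : ℂ, ‖z‖ = 1 / 2 → ‖F.eval z‖ₑ ^ p ≤
      3 * ∫⁻ θ, ‖F.eval (circleMap 0 1 θ)‖ₑ ^ p ∂harmonicMeasure 0 := fun z hz =>
    (enorm_eval_rpow_le_lintegral hp F (by rw [hz]; norm_num)).trans
      (lintegral_harmonicMeasure_le hz _)
  obtain ⟨z₀, hz₀, hmax⟩ := (isCompact_sphere (0 : ℂ) (1 / 2)).exists_isMaxOn
    (NormedSpace.sphere_nonempty.2 (by norm_num)) (f := fun z => ‖F.eval z‖)
    (F.continuous.norm.continuousOn)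
  have hc := Complex.norm_iteratedDeriv_le_of_forall_mem_sphere_norm_le (c := 0) (R := 1 / 2)
    (f := fun z => F.eval z) r (by norm_num) F.differentiable.diffContOnCl (fun z hz => hmax hz)
  have hco : ‖F.coeff r‖ ≤ 2 ^ r * ‖F.eval z₀‖ := by
    rw [iteratedDeriv_polynomial_eval] at hc
    beta_reduce at hc
    rw [← Polynomial.coeff_zero_eq_eval_zero,
      Polynomial.coeff_iterate_derivative] at hc
    simp only [zero_add, Nat.descFactorial_self, nsmul_eq_mul, norm_mul, Complex.norm_natCast] at hc
    have hf : (0 : ℝ) < r.factorial := by exact_mod_cast r.factorial_pos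
    rw [mul_div_assoc, mul_le_mul_iff_right₀ hf] at hc
    refine hc.trans_eq ?_
    simp [div_eq_mul_inv, mul_comm]
  have hco' : ‖F.coeff r‖ₑ ≤ 2 ^ r * ‖F.eval z₀‖ₑ := by
    have := ENNReal.ofReal_le_ofReal hco
    rw [ENNReal.ofReal_mul (by positivity), ofReal_norm, ofReal_norm,
      ENNReal.ofReal_pow (by norm_num)] at this
    simpa using this
  calc ‖F.coeff r‖ₑ ^ p ≤ (2 ^ r * ‖F.eval z₀‖ₑ) ^ p := by gcongr
    _ = (2 ^ r) ^ p * ‖F.eval z₀‖ₑ ^ p := ENNReal.mul_rpow_of_nonneg _ _ hp.le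
    _ ≤ (2 ^ r) ^ p * (3 * ∫⁻ θ, ‖F.eval (circleMap 0 1 θ)‖ₑ ^ p ∂harmonicMeasure 0) := by
        gcongr
        exact hpt z₀ (by simpa using hz₀)
    _ = _ := by ring

/-- The restriction of a real polynomial to the complexified line `z ↦ q + z v`. -/
def linePoly {m : ℕ} (q v : Fin m → ℝ) (P : MvPolynomial (Fin m) ℝ) : Polynomial ℂ :=
  MvPolynomial.aeval
    (fun i => Polynomial.C (q i : ℂ) + Polynomial.C (v i : ℂ) * Polynomial.X) P

theorem eval_linePoly {m : ℕ} (q v : Fin m → ℝ) (P : MvPolynomial (Fin m) ℝ) (z : ℂ) :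
    (linePoly q v P).eval z = MvPolynomial.aeval (fun i => (q i : ℂ) + v i * z) P := by
  have h := (MvPolynomial.comp_aeval_apply (R := ℝ)
    (fun i => Polynomial.C (q i : ℂ) + Polynomial.C (v i : ℂ) * Polynomial.X)
    ((Polynomial.aeval z : Polynomial ℂ →ₐ[ℂ] ℂ).restrictScalars ℝ) P)
  simpa [linePoly] using h

theorem dirOp_mul {m : ℕ} (v : Fin m → ℝ) (P Q : MvPolynomial (Fin m) ℝ) :
    dirOp v (P * Q) = dirOp v P * Q + P * dirOp v Q := by
  simp only [dirOp, Finset.sum_mul, Finset.mul_sum, ← Finset.sum_add_distrib]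
  refine Finset.sum_congr rfl fun i _ => ?_
  rw [MvPolynomial.pderiv_mul, smul_add, smul_mul_assoc, mul_smul_comm]

theorem derivative_linePoly {m : ℕ} (q v : Fin m → ℝ) (P : MvPolynomial (Fin m) ℝ) :
    (linePoly q v P).derivative = linePoly q v (dirOp v P) := by
  induction P using MvPolynomial.induction_on with
  | C a =>
    have h : dirOp v (MvPolynomial.C a : MvPolynomial (Fin m) ℝ) = 0 := by
      simp [dirOp]
    rw [h]
    simp [linePoly, Polynomial.algebraMap_apply]
  | add P Q hP hQ =>
    have h : dirOp v (P + Q) = dirOp v P + dirOp v Q := by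
      simp [dirOp, Finset.sum_add_distrib]
    rw [h]
    simp only [linePoly, map_add] at *
    rw [hP, hQ]
  | mul_X P i hP =>
    have h : dirOp v (MvPolynomial.X i : MvPolynomial (Fin m) ℝ) = MvPolynomial.C (v i) := by
      simp only [dirOp]
      rw [Finset.sum_eq_single i]
      · simp [MvPolynomial.smul_eq_C_mul]
      · intro j _ hj
        simp [MvPolynomial.pderiv_X_of_ne hj.symm]
      · simp
    rw [dirOp_mul, h]
    simp only [linePoly, map_add, map_mul, MvPolynomial.aeval_X, Polynomial.derivative_mul] at *
    rw [hP]
    simp [Polynomial.algebraMap_apply]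

theorem iterate_derivative_linePoly {m : ℕ} (q v : Fin m → ℝ) (P : MvPolynomial (Fin m) ℝ)
    (r : ℕ) : Polynomial.derivative^[r] (linePoly q v P) = linePoly q v ((dirOp v)^[r] P) := by
  induction r with
  | zero => rfl
  | succ k ih =>
    rw [Function.iterate_succ_apply', Function.iterate_succ_apply', ih, derivative_linePoly]

theorem aeval_ofReal {m : ℕ} (x : Fin m → ℝ) (P : MvPolynomial (Fin m) ℝ) :
    MvPolynomial.aeval (fun i => (x i : ℂ)) P = ((MvPolynomial.eval x P : ℝ) : ℂ) := by
  have := MvPolynomial.aeval_algebraMap_apply ℂ x P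
  rw [MvPolynomial.aeval_eq_eval] at this
  exact this

theorem eval_iterate_dirOp {m : ℕ} (q v : Fin m → ℝ) (P : MvPolynomial (Fin m) ℝ) (r : ℕ) :
    ((MvPolynomial.eval q ((dirOp v)^[r] P) : ℝ) : ℂ) = r.factorial * (linePoly q v P).coeff r := by
  have h1 : ((MvPolynomial.eval q ((dirOp v)^[r] P) : ℝ) : ℂ) =
      (Polynomial.derivative^[r] (linePoly q v P)).eval 0 := by
    rw [iterate_derivative_linePoly, eval_linePoly, ← aeval_ofReal]
    simp
  rw [h1, ← Polynomial.coeff_zero_eq_eval_zero, Polynomial.coeff_iterate_derivative]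
  simp [Nat.descFactorial_self]

theorem coeff_linePoly_smul {m : ℕ} (q v : Fin m → ℝ) (P : MvPolynomial (Fin m) ℝ) (R : ℝ)
    (r : ℕ) : (linePoly q (R • v) P).coeff r = (linePoly q v P).coeff r * (R : ℂ) ^ r := by
  have h : linePoly q (R • v) P = (linePoly q v P).comp (Polynomial.C (R : ℂ) * Polynomial.X) := by
    refine Polynomial.funext fun z => ?_
    rw [Polynomial.eval_comp, eval_linePoly, eval_linePoly]
    refine congrArg (fun x => MvPolynomial.aeval x P) (funext fun i => ?_)
    simp
    ring
  rw [h, Polynomial.comp_C_mul_X_coeff]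

theorem enorm_eval_iterate_dirOp_le {m : ℕ} (q v : Fin m → ℝ) (P : MvPolynomial (Fin m) ℝ)
    {x R : ℝ} (hx : 1 ≤ x * R) (hR : 0 < R) (r : ℕ) :
    ‖MvPolynomial.eval q ((dirOp v)^[r] P)‖ₑ ≤
      ENNReal.ofReal (r.factorial * x ^ r) * ‖(linePoly q (R • v) P).coeff r‖ₑ := by
  have hx0 : 0 ≤ x := by
    by_contra! h
    have := mul_neg_of_neg_of_pos h hR
    linarith
  have h3 : ‖MvPolynomial.eval q ((dirOp v)^[r] P)‖ =
      r.factorial * ‖(linePoly q v P).coeff r‖ := by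
    rw [← Complex.norm_real, eval_iterate_dirOp q v P r, norm_mul, Complex.norm_natCast]
  have h4 : ‖(linePoly q (R • v) P).coeff r‖ = ‖(linePoly q v P).coeff r‖ * R ^ r := by
    rw [coeff_linePoly_smul, norm_mul, norm_pow, Complex.norm_real, Real.norm_of_nonneg hR.le]
  rw [← ofReal_norm, ← ofReal_norm, ← ENNReal.ofReal_mul (by positivity)]
  refine ENNReal.ofReal_le_ofReal ?_
  rw [h3, h4]
  have h5 : 1 ≤ x ^ r * R ^ r := by
    rw [← mul_pow]
    exact one_le_pow₀ hx
  have h6 : 0 ≤ (r.factorial : ℝ) * ‖(linePoly q v P).coeff r‖ :=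
    mul_nonneg (Nat.cast_nonneg _) (norm_nonneg _)
  generalize (r.factorial : ℝ) = k at h6 ⊢
  generalize ‖(linePoly q v P).coeff r‖ = y at h6 ⊢
  calc k * y ≤ k * y * (x ^ r * R ^ r) := le_mul_of_one_le_right h6 h5
    _ = _ := by ring

/-- Clearing denominators in a polynomial of a vector of Laurent polynomials. -/
theorem exists_polynomial_eval_laurent {m n : ℕ} (P : MvPolynomial (Fin m) ℝ)
    (hP : P.totalDegree ≤ n) (L : Fin m → Polynomial ℂ) :
    ∃ Q : Polynomial ℂ, ∀ ζ : ℂ, ζ ≠ 0 →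
      Q.eval ζ = ζ ^ (2 * n) * MvPolynomial.aeval (fun i => (L i).eval ζ / ζ ^ 2) P := by
  refine ⟨∑ k ∈ P.support, Polynomial.C ((P.coeff k : ℝ) : ℂ) *
    Polynomial.X ^ (2 * (n - ∑ i, k i)) * ∏ i, L i ^ k i, fun ζ hζ => ?_⟩
  rw [MvPolynomial.aeval_def, MvPolynomial.eval₂_eq', Finset.mul_sum, Polynomial.eval_finsetSum]
  refine Finset.sum_congr rfl fun k hk => ?_
  have hk' : ∑ i, k i ≤ n := by
    refine le_trans ?_ hP
    have := MvPolynomial.le_totalDegree hk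
    rwa [Finsupp.sum_fintype _ _ (by simp)] at this
  have h1 : ζ ^ (2 * n) = ζ ^ (2 * (n - ∑ i, k i)) * ∏ i, (ζ ^ 2) ^ k i := by
    rw [Finset.prod_pow_eq_pow_sum, ← pow_mul, ← pow_add]
    congr 1
    omega
  have h2 : ∏ i, (L i).eval ζ ^ k i = (∏ i, (ζ ^ 2) ^ k i) * ∏ i, ((L i).eval ζ / ζ ^ 2) ^ k i := by
    rw [← Finset.prod_mul_distrib]
    refine Finset.prod_congr rfl fun i _ => ?_
    rw [← mul_pow, mul_div_cancel₀ _ (pow_ne_zero 2 hζ)]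
  simp only [Polynomial.eval_mul, Polynomial.eval_C, Polynomial.eval_pow, Polynomial.eval_X,
    Polynomial.eval_prod, Complex.coe_algebraMap]
  rw [h1, h2]
  ring

/-- The real point, seen through the angular variable `t` of a trigonometric curve of degree two,
from which the value at the complex point `q + R e^{iψ} v` is recovered. -/
def curveS (R δ : ℝ) (ω : ℝ × ℝ) : ℝ := R * Real.cos ω.1 + δ * Real.sin ω.1 * Real.sin ω.2

/-- The offset accompanying `curveS`. -/
def curveU (C R δ : ℝ) (ω : ℝ × ℝ) : ℝ := C * (R ^ 2 + δ ^ 2 * Real.sin ω.2 ^ 2)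

theorem enorm_aeval_rpow_le_lintegral {m n : ℕ} {p : ℝ} (hp : 0 < p)
    (P : MvPolynomial (Fin m) ℝ) (hP : P.totalDegree ≤ n) (q v e : Fin m → ℝ)
    {w C R δ ψ : ℝ} (hw : 0 < w) (hw1 : w < 1) (hwn : 1 / 2 ≤ w ^ (2 * n))
    (hR : R = δ * (w⁻¹ - w) / 2) :
    ‖MvPolynomial.aeval (fun i => (q i : ℂ) + (R • v) i * circleMap 0 1 ψ) P‖ₑ ^ p ≤
      2 ^ p * ∫⁻ θ, ‖MvPolynomial.eval
        (q + curveS R δ (ψ, θ) • v - curveU C R δ (ψ, θ) • e) P‖ₑ ^ p ∂harmonicMeasure w := by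
  let σ : ℂ → ℂ := fun ζ => (ζ - ζ⁻¹) / (2 * Complex.I)
  let L : Fin m → Polynomial ℂ := fun i =>
    Polynomial.C (q i : ℂ) * Polynomial.X ^ 2 + Polynomial.C (v i : ℂ) *
      (Polynomial.C ((R * Real.cos ψ : ℝ) : ℂ) * Polynomial.X ^ 2 +
        Polynomial.C (((δ * Real.sin ψ : ℝ) : ℂ) / (2 * Complex.I)) *
          (Polynomial.X ^ 3 - Polynomial.X)) -
    Polynomial.C ((e i * C : ℝ) : ℂ) * (Polynomial.C ((R ^ 2 : ℝ) : ℂ) * Polynomial.X ^ 2 -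
      Polynomial.C ((δ ^ 2 / 4 : ℝ) : ℂ) * (Polynomial.X ^ 2 - 1) ^ 2)
  have hL : ∀ ζ : ℂ, ζ ≠ 0 → ∀ i, (L i).eval ζ / ζ ^ 2 = q i +
      ((R * Real.cos ψ : ℝ) + (δ * Real.sin ψ : ℝ) * σ ζ) * v i -
        C * (R ^ 2 + δ ^ 2 * σ ζ ^ 2) * e i := by
    intro ζ hζ i
    have hI : (Complex.I) ^ 2 = -1 := Complex.I_sq
    simp only [L, σ, Polynomial.eval_add, Polynomial.eval_sub, Polynomial.eval_mul,
      Polynomial.eval_C, Polynomial.eval_pow, Polynomial.eval_X, Polynomial.eval_one]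
    push_cast
    rw [div_pow, mul_pow, hI]
    field_simp
    ring
  obtain ⟨Q, hQ⟩ := exists_polynomial_eval_laurent P hP L
  have hw' : ‖(w : ℂ)‖ < 1 := by
    rw [Complex.norm_real, Real.norm_of_nonneg hw.le]
    exact hw1
  have hw0 : (w : ℂ) ≠ 0 := by exact_mod_cast hw.ne'
  have hpt : MvPolynomial.aeval (fun i => (L i).eval (w : ℂ) / (w : ℂ) ^ 2) P =
      MvPolynomial.aeval (fun i => (q i : ℂ) + (R • v) i * circleMap 0 1 ψ) P := by
    have hσ : (δ : ℂ) * σ w = R * Complex.I := by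
      simp only [σ]
      rw [hR]
      push_cast
      have hI : (Complex.I) ^ 2 = -1 := Complex.I_sq
      field_simp
      rw [hI]
      ring
    refine congrArg (fun x => MvPolynomial.aeval x P) (funext fun i => ?_)
    rw [hL _ hw0]
    have h1 : (δ : ℂ) ^ 2 * σ w ^ 2 = - R ^ 2 := by
      rw [← mul_pow, hσ, mul_pow, Complex.I_sq]
      ring
    have h2 : ((δ * Real.sin ψ : ℝ) : ℂ) * σ w = R * Real.sin ψ * Complex.I := by
      push_cast
      linear_combination (Complex.sin ψ) * hσ
    rw [h1, h2]
    simp only [circleMap, Complex.exp_mul_I, Pi.smul_apply, smul_eq_mul]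
    push_cast
    ring
  have hcirc : ∀ θ : ℝ, ‖Q.eval (circleMap 0 1 θ)‖ₑ = ‖MvPolynomial.eval
        (q + curveS R δ (ψ, θ) • v - curveU C R δ (ψ, θ) • e) P‖ₑ := by
    intro θ
    have hζ : circleMap 0 1 θ ≠ 0 := circleMap_ne_center one_ne_zero
    have hn : ‖circleMap 0 1 θ ^ (2 * n)‖ₑ = 1 := by
      rw [← ofReal_norm, norm_pow]
      simp
    have hσ : σ (circleMap 0 1 θ) = Real.sin θ := by
      simp only [σ, circleMap, zero_add, Complex.ofReal_one, one_mul]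
      rw [← Complex.exp_neg, Complex.ofReal_sin, Complex.sin]
      have hI : (Complex.I) ^ 2 = -1 := Complex.I_sq
      field_simp
      rw [hI]
      ring
    rw [hQ _ hζ, enorm_mul, hn, one_mul]
    have : MvPolynomial.aeval (fun i => (L i).eval (circleMap 0 1 θ) / circleMap 0 1 θ ^ 2) P =
        ((MvPolynomial.eval
          (q + curveS R δ (ψ, θ) • v - curveU C R δ (ψ, θ) • e) P : ℝ) : ℂ) := by
      rw [← aeval_ofReal]
      refine congrArg (fun x => MvPolynomial.aeval x P) (funext fun i => ?_)
      rw [hL _ hζ, hσ]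
      simp only [curveS, curveU, Pi.add_apply, Pi.sub_apply, Pi.smul_apply, smul_eq_mul]
      push_cast
      ring
    rw [this, ← ofReal_norm, ← ofReal_norm, Complex.norm_real]
  have hmain := enorm_eval_rpow_le_lintegral hp Q hw'
  simp only [hcirc] at hmain
  have hle : ‖MvPolynomial.aeval (fun i => (q i : ℂ) + (R • v) i * circleMap 0 1 ψ) P‖ₑ ≤
      2 * ‖Q.eval (w : ℂ)‖ₑ := by
    rw [← hpt, hQ _ hw0]
    set A := MvPolynomial.aeval (fun i => (L i).eval (w : ℂ) / (w : ℂ) ^ 2) P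
    have : ‖A‖ ≤ 2 * ‖(w : ℂ) ^ (2 * n) * A‖ := by
      rw [norm_mul, norm_pow, Complex.norm_real, Real.norm_of_nonneg hw.le]
      nlinarith [norm_nonneg A]
    have h2 := ENNReal.ofReal_le_ofReal this
    rwa [ENNReal.ofReal_mul (by norm_num), ofReal_norm, ofReal_norm, ENNReal.ofReal_ofNat] at h2
  calc _ ≤ (2 * ‖Q.eval (w : ℂ)‖ₑ) ^ p := by gcongr
    _ = 2 ^ p * ‖Q.eval (w : ℂ)‖ₑ ^ p := ENNReal.mul_rpow_of_nonneg _ _ hp.le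
    _ ≤ _ := by gcongr

theorem continuous_curveS (R δ : ℝ) : Continuous (curveS R δ) := by
  unfold curveS
  fun_prop

theorem continuous_curveU (C R δ : ℝ) : Continuous (curveU C R δ) := by
  unfold curveU
  fun_prop

theorem curveS_sq_le (R δ : ℝ) (ω : ℝ × ℝ) :
    curveS R δ ω ^ 2 ≤ R ^ 2 + δ ^ 2 * Real.sin ω.2 ^ 2 := by
  have h := Real.sin_sq_add_cos_sq ω.1
  have : R ^ 2 + δ ^ 2 * Real.sin ω.2 ^ 2 - curveS R δ ω ^ 2 =
      (R * Real.sin ω.1 - δ * Real.sin ω.2 * Real.cos ω.1) ^ 2 := by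
    unfold curveS
    linear_combination -(R ^ 2 + δ ^ 2 * Real.sin ω.2 ^ 2) * h
  nlinarith [sq_nonneg (R * Real.sin ω.1 - δ * Real.sin ω.2 * Real.cos ω.1)]

/-- The pointwise tangential Bernstein inequality: `∂_v^r P (q)` is controlled, uniformly over
polynomials of degree `n`, by an average of `P` over points of the form `q + s v - u e` with
`u ≥ C s²`. -/
theorem exists_measure_tangential_bernstein {n : ℕ} (hn : 0 < n) {C δ : ℝ} (hC : 0 ≤ C)
    (hδ : 0 < δ) :
    ∃ (μ : Measure (ℝ × ℝ)) (s u : ℝ × ℝ → ℝ), IsProbabilityMeasure μ ∧ Continuous s ∧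
      Continuous u ∧ (∀ ω, |s ω| ≤ 2 * δ ∧ C * s ω ^ 2 ≤ u ω ∧ u ω ≤ 2 * C * δ ^ 2) ∧
      ∀ p : ℝ, 0 < p → ∀ (r m : ℕ) (P : MvPolynomial (Fin m) ℝ), P.totalDegree ≤ n →
        ∀ q v e : Fin m → ℝ,
          ‖MvPolynomial.eval q ((dirOp v)^[r] P)‖ₑ ^ p ≤
            3 * ENNReal.ofReal (2 * r.factorial * (16 / δ) ^ r * (n : ℝ) ^ r) ^ p *
              ∫⁻ ω, ‖MvPolynomial.eval (q + s ω • v - u ω • e) P‖ₑ ^ p ∂μ := by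
  have hn' : (1 : ℝ) ≤ n := by exact_mod_cast hn
  set w : ℝ := 1 - 1 / (4 * n) with hwdef
  have hx : 1 / (4 * (n : ℝ)) ≤ 1 / 4 := by
    rw [div_le_div_iff₀ (by positivity) (by norm_num)]
    linarith
  have hx0 : 0 < 1 / (4 * (n : ℝ)) := by positivity
  have hw34 : 3 / 4 ≤ w := by linarith
  have hw : 0 < w := by linarith
  have hw1 : w < 1 := by linarith
  have hwn : 1 / 2 ≤ w ^ (2 * n) := by
    have h := one_add_mul_le_pow (a := -(1 / (4 * (n : ℝ)))) (by linarith) (2 * n)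
    have h2 : 1 + ((2 * n : ℕ) : ℝ) * -(1 / (4 * (n : ℝ))) = 1 / 2 := by
      push_cast
      field_simp
      ring
    rw [h2] at h
    simpa [hwdef, sub_eq_add_neg] using h
  set R : ℝ := δ * (w⁻¹ - w) / 2 with hR
  have hwinv : w⁻¹ ≤ 4 / 3 := by
    rw [inv_le_comm₀ hw (by norm_num)]
    linarith
  have hwinv1 : 1 ≤ w⁻¹ := (one_le_inv₀ hw).2 hw1.le
  have hRn : δ / (8 * n) ≤ R := by
    have : δ / (8 * n) = δ * (1 - w) / 2 := by
      rw [hwdef]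
      field_simp
      ring
    rw [this, hR]
    nlinarith
  have hRpos : 0 < R := lt_of_lt_of_le (by positivity) hRn
  have hRδ : R ≤ δ := by
    rw [hR]
    nlinarith
  have hW : ‖(w : ℂ)‖ < 1 := by
    rw [Complex.norm_real, Real.norm_of_nonneg hw.le]
    exact hw1
  have := isProbabilityMeasure_harmonicMeasure hW
  have := isProbabilityMeasure_harmonicMeasure (w := 0) (by simp)
  refine ⟨(harmonicMeasure 0).prod (harmonicMeasure w), curveS R δ, curveU C R δ, inferInstance,
    continuous_curveS R δ, continuous_curveU C R δ, fun ω => ?_, ?_⟩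
  · have h1 := curveS_sq_le R δ ω
    have h2 : Real.sin ω.2 ^ 2 ≤ 1 := Real.sin_sq_le_one _
    have h3 : R ^ 2 ≤ δ ^ 2 := by gcongr
    have h4 : R ^ 2 + δ ^ 2 * Real.sin ω.2 ^ 2 ≤ 2 * δ ^ 2 := by nlinarith [sq_nonneg δ]
    refine ⟨abs_le_of_sq_le_sq (by nlinarith) (by positivity), ?_, ?_⟩
    · exact mul_le_mul_of_nonneg_left h1 hC
    · have := mul_le_mul_of_nonneg_left h4 hC
      unfold curveU
      linarith
  · intro p hp r m P hP q v e
    have hcoef := enorm_coeff_rpow_le_lintegral hp (linePoly q (R • v) P) r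
    simp only [eval_linePoly] at hcoef
    have hbound : ∫⁻ ψ, ‖MvPolynomial.aeval
        (fun i => (q i : ℂ) + (R • v) i * circleMap 0 1 ψ) P‖ₑ ^ p ∂harmonicMeasure 0 ≤
        2 ^ p * ∫⁻ ω, ‖MvPolynomial.eval
          (q + curveS R δ ω • v - curveU C R δ ω • e) P‖ₑ ^ p
            ∂((harmonicMeasure 0).prod (harmonicMeasure w)) := by
      have hcont : Continuous fun ω : ℝ × ℝ => MvPolynomial.eval
          (q + curveS R δ ω • v - curveU C R δ ω • e) P :=
        (MvPolynomial.continuous_eval P).comp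
          ((continuous_const.add ((continuous_curveS R δ).smul continuous_const)).sub
            ((continuous_curveU C R δ).smul continuous_const))
      rw [lintegral_prod _ (hcont.measurable.enorm.pow_const p).aemeasurable, ← lintegral_const_mul' _ _ (by finiteness)]
      exact lintegral_mono fun ψ => enorm_aeval_rpow_le_lintegral hp P hP q v e hw hw1 hwn hR
    have hpt := enorm_eval_iterate_dirOp_le q v P (x := 8 / δ * n) (by
      calc (1 : ℝ) = 8 / δ * n * (δ / (8 * n)) := by field_simp
          _ ≤ 8 / δ * n * R := by gcongr) hRpos r
    rw [mul_pow, ← mul_assoc] at hpt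
    have hconst : ENNReal.ofReal (r.factorial * (8 / δ) ^ r * (n : ℝ) ^ r) * 2 ^ r * 2 =
        ENNReal.ofReal (2 * r.factorial * (16 / δ) ^ r * (n : ℝ) ^ r) := by
      have h2 : (2 : ℝ≥0∞) = ENNReal.ofReal 2 := by simp
      rw [h2, ← ENNReal.ofReal_pow (by norm_num), ← ENNReal.ofReal_mul (by positivity),
        ← ENNReal.ofReal_mul (by positivity)]
      congr 1
      have : (16 / δ) ^ r = (8 / δ) ^ r * 2 ^ r := by
        rw [← mul_pow]
        congr 1
        ring
      rw [this]
      ring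
    calc _ ≤ (ENNReal.ofReal (r.factorial * (8 / δ) ^ r * (n : ℝ) ^ r) *
          ‖(linePoly q (R • v) P).coeff r‖ₑ) ^ p := by gcongr
      _ = ENNReal.ofReal (r.factorial * (8 / δ) ^ r * (n : ℝ) ^ r) ^ p *
          ‖(linePoly q (R • v) P).coeff r‖ₑ ^ p := ENNReal.mul_rpow_of_nonneg _ _ hp.le
      _ ≤ ENNReal.ofReal (r.factorial * (8 / δ) ^ r * (n : ℝ) ^ r) ^ p *
          (3 * ((2 : ℝ≥0∞) ^ r) ^ p * (2 ^ p * ∫⁻ ω, ‖MvPolynomial.eval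
          (q + curveS R δ ω • v - curveU C R δ ω • e) P‖ₑ ^ p
            ∂((harmonicMeasure 0).prod (harmonicMeasure w)))) := by
          gcongr
          exact hcoef.trans (by gcongr)
      _ = _ := by
          rw [← hconst, ENNReal.mul_rpow_of_nonneg _ _ hp.le, ENNReal.mul_rpow_of_nonneg _ _ hp.le]
          ring

theorem abs_sub_sub_le_mul_sq {φ φ₁ φ₂ : ℝ → ℝ} {K s : ℝ}
    (h1 : ∀ t ∈ Set.uIcc 0 s, HasDerivAt φ (φ₁ t) t)
    (h2 : ∀ t ∈ Set.uIcc 0 s, HasDerivAt φ₁ (φ₂ t) t)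
    (hK : ∀ t ∈ Set.uIcc 0 s, |φ₂ t| ≤ K) : |φ s - φ 0 - s * φ₁ 0| ≤ K * s ^ 2 := by
  have h0 : (0 : ℝ) ∈ Set.uIcc 0 s := Set.left_mem_uIcc
  have hs : s ∈ Set.uIcc 0 s := Set.right_mem_uIcc
  have hK0 : 0 ≤ K := (abs_nonneg _).trans (hK 0 h0)
  have hconv : Convex ℝ (Set.uIcc 0 s) := convex_uIcc 0 s
  have hφ₁ : ∀ t ∈ Set.uIcc 0 s, ‖φ₁ t - φ₁ 0‖ ≤ K * |s| := by
    intro t ht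
    refine (hconv.norm_image_sub_le_of_norm_hasDerivWithin_le
      (fun x hx => (h2 x hx).hasDerivWithinAt) hK h0 ht).trans ?_
    have := Set.abs_sub_left_of_mem_uIcc ht
    rw [Real.norm_eq_abs]
    simp only [sub_zero] at this ⊢
    gcongr
  have h3 : ∀ t ∈ Set.uIcc 0 s, HasDerivWithinAt (fun t => φ t - t * φ₁ 0) (φ₁ t - φ₁ 0)
      (Set.uIcc 0 s) t := by
    intro t ht
    have := ((h1 t ht).fun_sub ((hasDerivAt_id' t).mul_const (φ₁ 0))).hasDerivWithinAt
      (s := Set.uIcc 0 s)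
    rwa [one_mul] at this
  have h4 := hconv.norm_image_sub_le_of_norm_hasDerivWithin_le h3 hφ₁ h0 hs
  rw [Real.norm_eq_abs, Real.norm_eq_abs, sub_zero, zero_mul, sub_zero, mul_assoc,
    ← abs_mul, abs_mul_self, ← sq] at h4
  convert h4 using 2
  ring

/-- A bilinear form whose matrix entries are at most `M` is at most `d M` on unit vectors. -/
theorem abs_bilin_le {d : ℕ} (B : EuclideanSpace ℝ (Fin d) →L[ℝ] EuclideanSpace ℝ (Fin d) →L[ℝ] ℝ)
    {M : ℝ} (hB : ∀ i j, |B (EuclideanSpace.single i 1) (EuclideanSpace.single j 1)| ≤ M)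
    {ξ : EuclideanSpace ℝ (Fin d)} (hξ : ‖ξ‖ = 1) : |B ξ ξ| ≤ d * M := by
  have hsum : ξ = ∑ i, ξ i • EuclideanSpace.single i (1 : ℝ) := by
    have := (EuclideanSpace.basisFun (Fin d) ℝ).sum_repr ξ
    simpa using this.symm
  have hexp : B ξ ξ = ∑ i, ∑ j, ξ i * ξ j *
      B (EuclideanSpace.single i 1) (EuclideanSpace.single j 1) := by
    conv_lhs => rw [hsum]
    simp only [map_sum, map_smul, sum_apply, smul_apply,
      smul_eq_mul, Finset.mul_sum]
    rw [Finset.sum_comm]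
    refine Finset.sum_congr rfl fun i _ => Finset.sum_congr rfl fun j _ => ?_
    ring
  have hnorm : ∑ i, |ξ i| ^ 2 = 1 := by
    have := EuclideanSpace.norm_sq_eq ξ
    rw [hξ] at this
    simpa using this.symm
  have hcs : (∑ i, |ξ i|) ^ 2 ≤ d := by
    have := sq_sum_le_card_mul_sum_sq (s := Finset.univ) (f := fun i => |ξ i|)
    rw [hnorm] at this
    simpa using this
  rcases Nat.eq_zero_or_pos d with rfl | hd
  · simp [hexp]
  have hM : 0 ≤ M := (abs_nonneg _).trans (hB ⟨0, hd⟩ ⟨0, hd⟩)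
  calc |B ξ ξ| ≤ ∑ i, ∑ j, |ξ i| * |ξ j| * M := by
        rw [hexp]
        refine (Finset.abs_sum_le_sum_abs _ _).trans (Finset.sum_le_sum fun i _ => ?_)
        refine (Finset.abs_sum_le_sum_abs _ _).trans (Finset.sum_le_sum fun j _ => ?_)
        rw [abs_mul, abs_mul]
        gcongr
        exact hB i j
    _ = (∑ i, |ξ i|) ^ 2 * M := by
        rw [sq, Finset.sum_mul_sum, Finset.sum_mul]
        simp only [Finset.sum_mul]
    _ ≤ d * M := by gcongr

theorem cube_eq_preimage (d : ℕ) (c : ℝ) :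
    cube d c = EuclideanSpace.equiv (Fin d) ℝ ⁻¹' Set.pi Set.univ fun _ => Set.Icc (-c) c := by
  ext x
  simp only [cube, Set.mem_ofPred_eq, Set.mem_preimage, Set.mem_pi, Set.mem_univ, forall_const]
  rfl

theorem isClosed_cube (d : ℕ) (c : ℝ) : IsClosed (cube d c) := by
  rw [cube_eq_preimage]
  exact (isClosed_set_pi fun _ _ => isClosed_Icc).preimage (EuclideanSpace.equiv (Fin d) ℝ).continuous

theorem convex_cube (d : ℕ) (c : ℝ) : Convex ℝ (cube d c) := by
  rw [cube_eq_preimage]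
  exact (convex_pi fun _ _ => convex_Icc _ _).linear_preimage
    (EuclideanSpace.equiv (Fin d) ℝ).toLinearEquiv.toLinearMap

theorem cube_mem_nhds {d : ℕ} {c : ℝ} {x : EuclideanSpace ℝ (Fin d)} (hx : ∀ i, |x i| < c) :
    cube d c ∈ nhds x := by
  rw [cube_eq_preimage]
  refine (EuclideanSpace.equiv (Fin d) ℝ).continuous.continuousAt.preimage_mem_nhds ?_
  exact set_pi_mem_nhds Set.finite_univ fun i _ => Icc_mem_nhds (abs_lt.1 (hx i)).1 (abs_lt.1 (hx i)).2

theorem uniqueDiffOn_cube {d : ℕ} {c : ℝ} (hc : 0 < c) : UniqueDiffOn ℝ (cube d c) := by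
  refine uniqueDiffOn_convex (convex_cube d c) ⟨0, ?_⟩
  exact mem_interior_iff_mem_nhds.2 (cube_mem_nhds fun i => by simpa using hc)

theorem abs_taylor_le {d : ℕ} {c M : ℝ} (hc : 0 < c) {g : EuclideanSpace ℝ (Fin d) → ℝ}
    (hg : ContDiffOn ℝ 2 g (cube d c))
    (hM : ∀ x ∈ cube d c, ∀ i j : Fin d, |iteratedFDerivWithin ℝ 2 g (cube d c) x
      ![EuclideanSpace.single i 1, EuclideanSpace.single j 1]| ≤ M)
    {ξ x : EuclideanSpace ℝ (Fin d)} (hξ : ‖ξ‖ = 1) {s : ℝ} (hx : ∀ i, |x i| + |s| < c) :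
    |g (x + s • ξ) - g x - s * fderivWithin ℝ g (cube d c) x ξ| ≤ d * M * s ^ 2 := by
  have hu : UniqueDiffOn ℝ (cube d c) := uniqueDiffOn_cube hc
  have hξi : ∀ i, |ξ i| ≤ 1 := fun i => by
    have := PiLp.norm_apply_le ξ i
    rwa [hξ] at this
  have hmem : ∀ t ∈ Set.uIcc 0 s, cube d c ∈ nhds (x + t • ξ) := by
    intro t ht
    refine cube_mem_nhds fun i => ?_
    have h1 := Set.abs_sub_left_of_mem_uIcc ht
    simp only [sub_zero] at h1
    have h2 : |t * ξ i| ≤ |s| := by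
      rw [abs_mul]
      nlinarith [hξi i, abs_nonneg t, abs_nonneg (ξ i)]
    calc |(x + t • ξ) i| = |x i + t * ξ i| := by simp
      _ ≤ |x i| + |t * ξ i| := abs_add_le _ _
      _ < c := by linarith [hx i]
  have hline : ∀ t : ℝ, HasDerivAt (fun t : ℝ => x + t • ξ) ξ t := by
    intro t
    simpa using ((hasDerivAt_id t).smul_const ξ).const_add x
  have h1 : ∀ t ∈ Set.uIcc 0 s, HasDerivAt (fun t => g (x + t • ξ))
      (fderivWithin ℝ g (cube d c) (x + t • ξ) ξ) t := by
    intro t ht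
    have hd := ((hg.differentiableOn (by norm_num)) _ (mem_of_mem_nhds (hmem t ht))).hasFDerivWithinAt
    exact (hd.hasFDerivAt (hmem t ht)).comp_hasDerivAt t (hline t)
  have h2 : ∀ t ∈ Set.uIcc 0 s,
      HasDerivAt (fun t => fderivWithin ℝ g (cube d c) (x + t • ξ) ξ)
      (fderivWithin ℝ (fderivWithin ℝ g (cube d c)) (cube d c) (x + t • ξ) ξ ξ) t := by
    intro t ht
    have hc1 : ContDiffOn ℝ 1 (fderivWithin ℝ g (cube d c)) (cube d c) :=
      hg.fderivWithin hu (by norm_num)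
    have hd := ((hc1.differentiableOn (by norm_num)) _
      (mem_of_mem_nhds (hmem t ht))).hasFDerivWithinAt
    have : HasDerivAt (fun t => fderivWithin ℝ g (cube d c) (x + t • ξ))
        (fderivWithin ℝ (fderivWithin ℝ g (cube d c)) (cube d c) (x + t • ξ) ξ) t :=
      (hd.hasFDerivAt (hmem t ht)).comp_hasDerivAt t (hline t)
    simpa using this.clm_apply (hasDerivAt_const t ξ)
  have h3 : ∀ t ∈ Set.uIcc 0 s,
      |fderivWithin ℝ (fderivWithin ℝ g (cube d c)) (cube d c) (x + t • ξ) ξ ξ| ≤ d * M := by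
    intro t ht
    refine abs_bilin_le _ (fun i j => ?_) hξ
    have hz := mem_of_mem_nhds (hmem t ht)
    have := hM _ hz i j
    rw [iteratedFDerivWithin_two_apply g hu hz] at this
    simpa using this
  simpa using abs_sub_sub_le_mul_sq h1 h2 h3

/-- Averaging over measure preserving maps which send `s` into `t`. -/
theorem setLIntegral_lintegral_comp_le {Ω X : Type*} [MeasurableSpace Ω] [MeasurableSpace X]
    {μ : Measure Ω} [IsProbabilityMeasure μ] {ν : Measure X} [SFinite ν] {T : Ω → X → X}
    (hT : Measurable fun z : X × Ω => T z.2 z.1) (hTν : ∀ ω, MeasurePreserving (T ω) ν ν)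
    {s t : Set X} (ht : MeasurableSet t) (hst : ∀ ω, ∀ q ∈ s, T ω q ∈ t)
    {h : X → ℝ≥0∞} (hh : Measurable h) :
    ∫⁻ q in s, ∫⁻ ω, h (T ω q) ∂μ ∂ν ≤ ∫⁻ q in t, h q ∂ν := by
  rw [lintegral_lintegral_swap (f := fun q ω => h (T ω q)) (hh.comp hT).aemeasurable]
  calc ∫⁻ ω, ∫⁻ q in s, h (T ω q) ∂ν ∂μ ≤ ∫⁻ _, ∫⁻ q in t, h q ∂ν ∂μ := by
        refine lintegral_mono fun ω => ?_
        rw [← (hTν ω).setLIntegral_comp_preimage ht hh]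
        exact lintegral_mono_set fun q hq => hst ω q hq
    _ = ∫⁻ q in t, h q ∂ν := by simp

/-- Pointwise averaged bounds for all exponents transfer to `L^p` bounds. -/
theorem eLpNorm_restrict_le_of_average {Ω X : Type*} [MeasurableSpace Ω] [MeasurableSpace X]
    {μ : Measure Ω} [IsProbabilityMeasure μ] {ν : Measure X} [SFinite ν] {T : Ω → X → X}
    (hT : Measurable fun z : X × Ω => T z.2 z.1) (hTν : ∀ ω, MeasurePreserving (T ω) ν ν)
    {s t : Set X} (hs : MeasurableSet s) (ht : MeasurableSet t) (hst : ∀ ω, ∀ q ∈ s, T ω q ∈ t)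
    {f φ : X → ℝ} (hf : Measurable f) {A K : ℝ≥0∞} (hA : 1 ≤ A)
    (hφ : ∀ p : ℝ, 0 < p → ∀ q ∈ s, ‖φ q‖ₑ ^ p ≤ A * K ^ p * ∫⁻ ω, ‖f (T ω q)‖ₑ ^ p ∂μ)
    {p : ℝ≥0∞} (hp : 0 < p) :
    eLpNorm φ p (ν.restrict s) ≤ A * A ^ (1 / p.toReal) * K * eLpNorm f p (ν.restrict t) := by
  rcases eq_or_ne p ∞ with rfl | hptop
  · set S := eLpNorm f ∞ (ν.restrict t) with hS
    have hfS : ∀ᵐ q ∂ν.restrict t, ‖f q‖ₑ ≤ S := by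
      rw [hS, eLpNorm_exponent_top]
      exact ae_le_eLpNormEssSup
    have hh : Measurable fun q => ‖f q‖ₑ - S := hf.enorm.sub_const S
    have h0 : ∫⁻ q in s, ∫⁻ ω, (‖f (T ω q)‖ₑ - S) ∂μ ∂ν = 0 := by
      refine le_antisymm ((setLIntegral_lintegral_comp_le hT hTν ht hst hh).trans_eq ?_) zero_le
      rw [lintegral_eq_zero_iff hh]
      filter_upwards [hfS] with q hq using tsub_eq_zero_of_le hq
    have hm : Measurable fun q => ∫⁻ ω, (‖f (T ω q)‖ₑ - S) ∂μ :=
      Measurable.lintegral_prod_right' (hh.comp hT)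
    rw [lintegral_eq_zero_iff hm] at h0
    have h1 : ∀ᵐ q ∂ν.restrict s, ‖φ q‖ₑ ≤ A * K * S := by
      filter_upwards [h0, ae_restrict_mem hs] with q hq hqs
      have := hφ 1 one_pos q hqs
      simp only [ENNReal.rpow_one] at this
      refine this.trans ?_
      gcongr
      calc ∫⁻ ω, ‖f (T ω q)‖ₑ ∂μ ≤ ∫⁻ ω, ((‖f (T ω q)‖ₑ - S) + S) ∂μ :=
            lintegral_mono fun ω => le_tsub_add
        _ = S := by
            rw [lintegral_add_right _ measurable_const]
            simp only [Pi.zero_apply] at hq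
            rw [hq, lintegral_const, measure_univ, zero_add, mul_one]
    rw [eLpNorm_exponent_top]
    simpa using! essSup_le_of_ae_le _ h1
  · have hp0 : 0 < p.toReal := ENNReal.toReal_pos hp.ne' hptop
    have hfp : Measurable fun q => ‖f q‖ₑ ^ p.toReal := hf.enorm.pow_const _
    rw [eLpNorm_eq_lintegral_rpow_enorm_toReal hp.ne' hptop,
      eLpNorm_eq_lintegral_rpow_enorm_toReal hp.ne' hptop]
    have h1 : ∫⁻ q in s, ‖φ q‖ₑ ^ p.toReal ∂ν ≤
        A * K ^ p.toReal * ∫⁻ q in t, ‖f q‖ₑ ^ p.toReal ∂ν := by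
      calc ∫⁻ q in s, ‖φ q‖ₑ ^ p.toReal ∂ν
          ≤ ∫⁻ q in s, A * K ^ p.toReal * ∫⁻ ω, ‖f (T ω q)‖ₑ ^ p.toReal ∂μ ∂ν :=
            setLIntegral_mono' hs fun q hq => hφ _ hp0 q hq
        _ = A * K ^ p.toReal * ∫⁻ q in s, ∫⁻ ω, ‖f (T ω q)‖ₑ ^ p.toReal ∂μ ∂ν :=
            lintegral_const_mul _ (Measurable.lintegral_prod_right' (hfp.comp hT))
        _ ≤ _ := by
            refine mul_le_mul_right ?_ _
            exact setLIntegral_lintegral_comp_le hT hTν ht hst hfp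
    calc _ ≤ (A * K ^ p.toReal * ∫⁻ q in t, ‖f q‖ₑ ^ p.toReal ∂ν) ^ (1 / p.toReal) := by gcongr
      _ = 1 * A ^ (1 / p.toReal) * K * (∫⁻ q in t, ‖f q‖ₑ ^ p.toReal ∂ν) ^ (1 / p.toReal) := by
          rw [ENNReal.mul_rpow_of_nonneg _ _ (by positivity),
            ENNReal.mul_rpow_of_nonneg _ _ (by positivity), ← ENNReal.rpow_mul,
            mul_one_div_cancel hp0.ne', ENNReal.rpow_one, one_mul]
      _ ≤ _ := by gcongr

/-- The splitting `ℝ^{d+1} = ℝ^d × ℝ`. -/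
theorem measurePreserving_xpart_ypart (d : ℕ) :
    MeasurePreserving (fun q : EuclideanSpace ℝ (Fin (d + 1)) => (xpart q, ypart q)) volume
      (volume.prod volume) := by
  have h1 := (volume_preserving_piFinSuccAbove (fun _ : Fin (d + 1) => ℝ) (Fin.last d)).comp
    (PiLp.volume_preserving_ofLp (Fin (d + 1)))
  have h2 := ((PiLp.volume_preserving_toLp (Fin d)).prod
    (MeasurePreserving.id (volume : Measure ℝ))).comp Measure.measurePreserving_swap
  have h3 : (fun q : EuclideanSpace ℝ (Fin (d + 1)) => (xpart q, ypart q)) =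
      (Prod.map (WithLp.toLp 2) id ∘ Prod.swap) ∘
        (MeasurableEquiv.piFinSuccAbove (fun _ : Fin (d + 1) => ℝ) (Fin.last d)) ∘ WithLp.ofLp := by
    ext1 q
    refine Prod.ext ?_ rfl
    ext i
    simp [xpart, MeasurableEquiv.piFinSuccAbove, Fin.insertNthEquiv, Fin.init]
  rw [h3]
  exact h2.comp h1

/-- The inverse of the splitting `ℝ^{d+1} = ℝ^d × ℝ`. -/
theorem measurePreserving_snoc (d : ℕ) :
    MeasurePreserving (fun z : EuclideanSpace ℝ (Fin d) × ℝ =>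
      (WithLp.toLp 2 (Fin.snoc (α := fun _ => ℝ) (fun i => z.1 i) z.2) :
        EuclideanSpace ℝ (Fin (d + 1)))) (volume.prod volume) volume := by
  have h1 := (PiLp.volume_preserving_toLp (Fin (d + 1))).comp
    (volume_preserving_piFinSuccAbove (fun _ : Fin (d + 1) => ℝ) (Fin.last d)).symm
  have h2 := Measure.measurePreserving_swap.comp ((PiLp.volume_preserving_ofLp (Fin d)).prod
    (MeasurePreserving.id (volume : Measure ℝ)))
  have h3 : (fun z : EuclideanSpace ℝ (Fin d) × ℝ =>
      (WithLp.toLp 2 (Fin.snoc (α := fun _ => ℝ) (fun i => z.1 i) z.2) :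
        EuclideanSpace ℝ (Fin (d + 1)))) =
      (WithLp.toLp 2 ∘ (MeasurableEquiv.piFinSuccAbove (fun _ : Fin (d + 1) => ℝ)
        (Fin.last d)).symm) ∘ Prod.swap ∘ Prod.map WithLp.ofLp id := by
    ext1 z
    simp [MeasurableEquiv.piFinSuccAbove, Fin.insertNthEquiv]
  rw [h3]
  exact h1.comp h2

/-- The shear `(x, y) ↦ (x + s ξ, y + s b(x) - u)` of `ℝ^{d+1}`. -/
def shear {d : ℕ} (ξ : EuclideanSpace ℝ (Fin d)) (b : EuclideanSpace ℝ (Fin d) → ℝ) (s u : ℝ)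
    (q : EuclideanSpace ℝ (Fin (d + 1))) : EuclideanSpace ℝ (Fin (d + 1)) :=
  WithLp.toLp 2 (Fin.snoc (α := fun _ => ℝ) (fun i => (xpart q + s • ξ) i)
    (ypart q + (s * b (xpart q) - u)))

theorem xpart_shear {d : ℕ} (ξ : EuclideanSpace ℝ (Fin d)) (b : EuclideanSpace ℝ (Fin d) → ℝ)
    (s u : ℝ) (q : EuclideanSpace ℝ (Fin (d + 1))) : xpart (shear ξ b s u q) = xpart q + s • ξ := by
  ext i
  simp [xpart, shear]

theorem ypart_shear {d : ℕ} (ξ : EuclideanSpace ℝ (Fin d)) (b : EuclideanSpace ℝ (Fin d) → ℝ)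
    (s u : ℝ) (q : EuclideanSpace ℝ (Fin (d + 1))) :
    ypart (shear ξ b s u q) = ypart q + (s * b (xpart q) - u) := by
  simp [ypart, shear]

theorem shear_apply {d : ℕ} (ξ : EuclideanSpace ℝ (Fin d)) (b : EuclideanSpace ℝ (Fin d) → ℝ)
    (s u : ℝ) (q : EuclideanSpace ℝ (Fin (d + 1))) :
    (fun i => shear ξ b s u q i) = (fun i => q i) +
      s • (Fin.snoc (fun i => ξ i) (b (xpart q)) : Fin (d + 1) → ℝ) -
        u • (Pi.single (Fin.last d) 1 : Fin (d + 1) → ℝ) := by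
  funext i
  refine Fin.lastCases ?_ (fun i => ?_) i
  · simp [shear, ypart]
    ring
  · simp [shear, xpart, (Fin.castSucc_lt_last i).ne]

theorem measurePreserving_shear {d : ℕ} (ξ : EuclideanSpace ℝ (Fin d))
    {b : EuclideanSpace ℝ (Fin d) → ℝ} (hb : Measurable b) (s u : ℝ) :
    MeasurePreserving (shear ξ b s u) volume volume := by
  have h : MeasurePreserving (fun z : EuclideanSpace ℝ (Fin d) × ℝ =>
      (z.1 + s • ξ, z.2 + (s * b z.1 - u))) (volume.prod volume) (volume.prod volume) := by
    refine (measurePreserving_add_right volume (s • ξ)).skew_product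
      (g := fun x y => y + (s * b x - u)) (by unfold Function.uncurry; fun_prop) ?_
    exact Filter.Eventually.of_forall fun x => (measurePreserving_add_right volume _).map_eq
  exact (measurePreserving_snoc d).comp (h.comp (measurePreserving_xpart_ypart d))

theorem measurable_xpart (d : ℕ) : Measurable (xpart (d := d)) :=
  measurable_fst.comp (measurePreserving_xpart_ypart d).measurable

theorem measurable_ypart (d : ℕ) : Measurable (ypart (d := d)) :=
  measurable_snd.comp (measurePreserving_xpart_ypart d).measurable

theorem measurable_shear {Ω : Type*} [MeasurableSpace Ω] {d : ℕ} (ξ : EuclideanSpace ℝ (Fin d))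
    {b : EuclideanSpace ℝ (Fin d) → ℝ} (hb : Measurable b) {s u : Ω → ℝ} (hs : Measurable s)
    (hu : Measurable u) :
    Measurable fun z : EuclideanSpace ℝ (Fin (d + 1)) × Ω => shear ξ b (s z.2) (u z.2) z.1 := by
  have hx := measurable_xpart d
  have hy := measurable_ypart d
  exact (measurePreserving_snoc d).measurable.comp
    (f := fun z : EuclideanSpace ℝ (Fin (d + 1)) × Ω =>
      (xpart z.1 + s z.2 • ξ, ypart z.1 + (s z.2 * b (xpart z.1) - u z.2))) (by fun_prop)

theorem ContinuousOn.measurable_indicator_cube {d : ℕ} {c : ℝ} {f : EuclideanSpace ℝ (Fin d) → ℝ}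
    (hf : ContinuousOn f (cube d c)) : Measurable ((cube d c).indicator f) := by
  classical
  rw [← Set.piecewise_eq_indicator]
  exact hf.measurable_piecewise continuousOn_const (isClosed_cube d c).measurableSet

/-- The domain of special type of width `c` below the graph of `g`. -/
theorem measurableSet_special {d : ℕ} {c c' : ℝ} (hc : c ≤ c') {g : EuclideanSpace ℝ (Fin d) → ℝ}
    (hg : ContinuousOn g (cube d c')) :
    MeasurableSet {q : EuclideanSpace ℝ (Fin (d + 1)) | (∀ i, xpart q i ∈ Set.Ioo (-c) c) ∧
      g (xpart q) - c < ypart q ∧ ypart q ≤ g (xpart q)} := by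
  have hG := hg.measurable_indicator_cube.comp (measurable_xpart d)
  have hy := measurable_ypart d
  have : {q : EuclideanSpace ℝ (Fin (d + 1)) | (∀ i, xpart q i ∈ Set.Ioo (-c) c) ∧
      g (xpart q) - c < ypart q ∧ ypart q ≤ g (xpart q)} =
      (⋂ i, {q | xpart q i ∈ Set.Ioo (-c) c}) ∩
      ({q | ((cube d c').indicator g ∘ xpart) q - c < ypart q} ∩
        {q | ypart q ≤ ((cube d c').indicator g ∘ xpart) q}) := by
    ext q
    simp only [Set.mem_ofPred_eq, Set.mem_inter_iff, Set.mem_iInter, Function.comp_apply]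
    refine and_congr_right fun hq => ?_
    rw [Set.indicator_of_mem fun i => ⟨by linarith [(hq i).1], by linarith [(hq i).2]⟩]
  rw [this]
  refine (MeasurableSet.iInter fun i => ?_).inter
    ((measurableSet_lt (hG.sub_const c) hy).inter (measurableSet_le hy hG))
  have hxi : Measurable fun q : EuclideanSpace ℝ (Fin (d + 1)) => xpart q i :=
    (EuclideanSpace.proj i).continuous.measurable.comp (measurable_xpart d)
  exact hxi measurableSet_Ioo

/-- Shears moving along the tangent direction by a small `s`, and downwards by an amount which
dominates the second order error, map the special domain into a slightly larger one. -/
theorem shear_mem_special {d : ℕ} {lam a C δ s u : ℝ} (hlam : lam ≤ 2) (ha : 1 ≤ a)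
    {g : EuclideanSpace ℝ (Fin d) → ℝ} {b : EuclideanSpace ℝ (Fin d) → ℝ}
    {ξ : EuclideanSpace ℝ (Fin d)} (hξ : ‖ξ‖ = 1)
    (hgb : ∀ x : EuclideanSpace ℝ (Fin d), (∀ i, |x i| + |s| < 2 * a) → (∀ i, |x i| < a) →
      |g (x + s • ξ) - g x - s * b x| ≤ C * s ^ 2)
    (hδ : 2 * δ ≤ lam - 1) (hCδ : 4 * C * δ ^ 2 ≤ lam - 1)
    (hs : |s| ≤ 2 * δ) (hsu : C * s ^ 2 ≤ u) (hu : u ≤ 2 * C * δ ^ 2)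
    {q : EuclideanSpace ℝ (Fin (d + 1))}
    (hq : (∀ i, xpart q i ∈ Set.Ioo (-a) a) ∧ g (xpart q) - a < ypart q ∧ ypart q ≤ g (xpart q)) :
    (∀ i, xpart (shear ξ b s u q) i ∈ Set.Ioo (-(lam * a)) (lam * a)) ∧
      g (xpart (shear ξ b s u q)) - lam * a < ypart (shear ξ b s u q) ∧
      ypart (shear ξ b s u q) ≤ g (xpart (shear ξ b s u q)) := by
  obtain ⟨hx, hy1, hy2⟩ := hq
  have hx' : ∀ i, |xpart q i| < a := fun i => abs_lt.2 (hx i)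
  have hs0 := abs_nonneg s
  have hla : a + (lam - 1) ≤ lam * a := by nlinarith
  have hT := abs_le.1 (hgb (xpart q) (fun i => by linarith [hx' i]) hx')
  rw [xpart_shear, ypart_shear]
  refine ⟨fun i => ?_, by linarith [hT.2], by linarith [hT.1]⟩
  rw [Set.mem_Ioo, ← abs_lt]
  have hξi : |s * ξ i| ≤ |s| := by
    have := PiLp.norm_apply_le ξ i
    rw [hξ, Real.norm_eq_abs] at this
    rw [abs_mul]
    exact mul_le_of_le_one_right hs0 this
  calc |(xpart q + s • ξ) i| = |xpart q i + s * ξ i| := by simp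
    _ ≤ |xpart q i| + |s * ξ i| := abs_add_le _ _
    _ < lam * a := by linarith [hx' i]

/-- Lemma `lem-11-2`, Dai–Prymak.
Tangential Bernstein inequality along an arbitrary direction `ξ ∈ S^{d-1}`:
`‖D̃_ξ^r f‖_{L^p(G)} ≤ c n^r ‖f‖_{L^p(G(λ))}` on a domain of special type in `ℝ^{d+1}`. -/
theorem statement15 (d : ℕ) (hd : 0 < d) (p : ℝ≥0∞) (hp : 0 < p)
    (lam M : ℝ) (hlam : 1 < lam ∧ lam ≤ 2) (hM : 10 < M) (r : ℕ) (hr : 0 < r) :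
    ∃ c : ℝ≥0, 0 < c ∧
      ∀ a : ℝ, 1 ≤ a →
      ∀ g : EuclideanSpace ℝ (Fin d) → ℝ, ContDiffOn ℝ 2 g (cube d (2 * a)) →
        (∀ x ∈ cube d (2 * a), 4 * a ≤ g x) →
        (∀ x ∈ cube d (2 * a), ∀ i j : Fin d,
          |iteratedFDerivWithin ℝ 2 g (cube d (2 * a)) x
              ![EuclideanSpace.single i 1, EuclideanSpace.single j 1]| ≤ M) →
        ‖fderivWithin ℝ g (cube d (2 * a)) 0‖ ≤ M →
      ∀ n : ℕ, 0 < n →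
      ∀ P : MvPolynomial (Fin (d + 1)) ℝ, P.totalDegree ≤ n →
      ∀ ξ : EuclideanSpace ℝ (Fin d), ‖ξ‖ = 1 →
        eLpNorm (fun q : EuclideanSpace ℝ (Fin (d + 1)) =>
            MvPolynomial.eval (fun i => q i)
              ((dirOp (Fin.snoc (fun i => ξ i)
                  (fderivWithin ℝ g (cube d (2 * a)) (xpart q) ξ)))^[r] P))
          p (volume.restrict
            {q : EuclideanSpace ℝ (Fin (d + 1)) |
              (∀ i, xpart q i ∈ Set.Ioo (-a) a) ∧
              g (xpart q) - a < ypart q ∧ ypart q ≤ g (xpart q)}) ≤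
        (c : ℝ≥0∞) * (n : ℝ≥0∞) ^ r *
          eLpNorm (fun q : EuclideanSpace ℝ (Fin (d + 1)) =>
              MvPolynomial.eval (fun i => q i) P)
            p (volume.restrict
              {q : EuclideanSpace ℝ (Fin (d + 1)) |
                (∀ i, xpart q i ∈ Set.Ioo (-(lam * a)) (lam * a)) ∧
                g (xpart q) - lam * a < ypart q ∧ ypart q ≤ g (xpart q)}) := by
  obtain ⟨hlam1, hlam2⟩ := hlam
  have hd1 : (1 : ℝ) ≤ d := by exact_mod_cast hd
  have hC : 10 < d * M := by nlinarith
  set C : ℝ := d * M with hCdef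
  have hC0 : 0 < C := by linarith
  set δ : ℝ := (lam - 1) / (4 * C) with hδdef
  have hδ : 0 < δ := div_pos (by linarith) (by linarith)
  have hCδ : 4 * C * δ = lam - 1 := by
    rw [hδdef]
    field_simp
  have hδ1 : 2 * δ ≤ lam - 1 := by nlinarith
  have hδ2 : 4 * C * δ ^ 2 ≤ lam - 1 := by nlinarith
  set c₀ : ℝ := 2 * r.factorial * (16 / δ) ^ r with hc₀
  have hc₀pos : 0 < c₀ := by positivity
  refine ⟨3 * 3 ^ (1 / p.toReal) * c₀.toNNReal, ?_, ?_⟩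
  · have h1 : (0 : ℝ≥0) < 3 ^ (1 / p.toReal) := NNReal.rpow_pos (by norm_num)
    have h2 : 0 < c₀.toNNReal := Real.toNNReal_pos.2 hc₀pos
    positivity
  intro a ha g hg _ hgM _ n hn P hP ξ hξ
  have h2a : 0 < 2 * a := by linarith
  obtain ⟨μ, s, u, hμ, hs, hu, hsu, hbern⟩ :=
    exists_measure_tangential_bernstein hn hC0.le hδ
  set b : EuclideanSpace ℝ (Fin d) → ℝ :=
    (cube d (2 * a)).indicator fun x => fderivWithin ℝ g (cube d (2 * a)) x ξ with hbdef
  have hb : Measurable b := by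
    refine ContinuousOn.measurable_indicator_cube ?_
    exact (hg.continuousOn_fderivWithin (uniqueDiffOn_cube h2a) (by norm_num)).clm_apply
      continuousOn_const
  have hb_eq : ∀ x : EuclideanSpace ℝ (Fin d), (∀ i, |x i| < a) →
      b x = fderivWithin ℝ g (cube d (2 * a)) x ξ := by
    intro x hx
    refine Set.indicator_of_mem (fun i => ?_) _
    exact abs_le.1 (by linarith [hx i])
  have hmain := eLpNorm_restrict_le_of_average (μ := μ) (ν := volume)
    (T := fun ω => shear ξ b (s ω) (u ω))
    (s := {q : EuclideanSpace ℝ (Fin (d + 1)) | (∀ i, xpart q i ∈ Set.Ioo (-a) a) ∧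
      g (xpart q) - a < ypart q ∧ ypart q ≤ g (xpart q)})
    (t := {q : EuclideanSpace ℝ (Fin (d + 1)) |
      (∀ i, xpart q i ∈ Set.Ioo (-(lam * a)) (lam * a)) ∧
      g (xpart q) - lam * a < ypart q ∧ ypart q ≤ g (xpart q)})
    (f := fun q => MvPolynomial.eval (fun i => q i) P)
    (φ := fun q => MvPolynomial.eval (fun i => q i) ((dirOp (Fin.snoc (fun i => ξ i)
      (fderivWithin ℝ g (cube d (2 * a)) (xpart q) ξ)))^[r] P))
    (A := 3) (K := ENNReal.ofReal (c₀ * (n : ℝ) ^ r)) (p := p)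
    (measurable_shear ξ hb hs.measurable hu.measurable)
    (fun ω => measurePreserving_shear ξ hb _ _)
    (measurableSet_special (by linarith) hg.continuousOn)
    (measurableSet_special (by nlinarith) hg.continuousOn)
    (fun ω q hq => ?_) ?_ (by norm_num) (fun p' hp' q hq => ?_) hp
  · refine hmain.trans_eq ?_
    congr 1
    rw [ENNReal.ofReal_mul hc₀pos.le, ENNReal.ofReal_pow (by positivity), ENNReal.ofReal_natCast]
    push_cast
    rw [ENNReal.coe_rpow_of_ne_zero (by norm_num), ENNReal.ofReal]
    push_cast
    ring
  · obtain ⟨h1, h2, h3⟩ := hsu ω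
    refine shear_mem_special hlam2 ha hξ (fun x hx hx' => ?_) hδ1 hδ2 h1 h2 h3 hq
    rw [hb_eq x hx']
    exact abs_taylor_le h2a hg hgM hξ hx
  · have : Continuous fun q : EuclideanSpace ℝ (Fin (d + 1)) =>
        MvPolynomial.eval (fun i => q i) P := by
      refine (MvPolynomial.continuous_eval P).comp ?_
      fun_prop
    exact this.measurable
  · have hb' := hb_eq (xpart q) fun i => abs_lt.2 (hq.1 i)
    simp only [shear_apply]
    rw [hb']
    exact hbern p' hp' r (d + 1) P hP _ _ _
end
end
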